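/- arXiv:2403.00201 — 3 statements merged into one kernel-verified Lean document; each statement's English description precedes it below -/
import Mathlib

section
/- The problem of deciding whether a given L-formula is valid on the class of all GS4 frames is decidable; consequently the logic GS4 is decidable. Moreover, a formula φ whose set Σ of subformulas is finite is falsifiable on some GS4 frame if and only if it is falsifiable on a GS4 frame with at most (|Σ|+1)·2^{|Σ|(|Σ|+1)+1} worlds. -/
universe u

/-- Formulas of the intuitionistic modal language `L`, with a countably infinite
set of propositional variables indexed by `ℕ`. -/
inductive Fml : Type where
  | var : ℕ → Fml
  | bot : Fml
  | and : Fml → Fml → Fml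
  | or : Fml → Fml → Fml
  | imp : Fml → Fml → Fml
  | dia : Fml → Fml
  | box : Fml → Fml
  deriving DecidableEq

/-- A birelational structure: a set of worlds, a set of fallible worlds, an
intuitionistic relation `le` (`≼`), a modal relation `sq` (`⊑`) and a valuation. -/
structure KModel : Type (u + 1) where
  W : Type u
  fallible : Set W
  le : W → W → Prop
  sq : W → W → Prop
  val : ℕ → Set W

namespace KModel

/-- The satisfaction relation. -/
def Sat (M : KModel.{u}) : Fml → M.W → Prop
  | .var p, w => w ∈ M.val p
  | .bot, w => w ∈ M.fallible
  | .and φ ψ, w => Sat M φ w ∧ Sat M ψ w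
  | .or φ ψ, w => Sat M φ w ∨ Sat M ψ w
  | .imp φ ψ, w => ∀ v, M.le w v → Sat M φ v → Sat M ψ v
  | .dia φ, w => ∀ u, M.le w u → ∃ v, M.sq u v ∧ Sat M φ v
  | .box φ, w => ∀ u v, M.le w u → M.sq u v → Sat M φ v

/-- `M` is a bi-intuitionistic model: both relations are preorders, the set of
fallible worlds is closed under both relations, and the valuation is
`≼`-monotone and contains the fallible worlds. -/
def IsBiInt (M : KModel.{u}) : Prop :=
  (∀ w, M.le w w) ∧ (∀ u v w, M.le u v → M.le v w → M.le u w) ∧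
  (∀ w, M.sq w w) ∧ (∀ u v w, M.sq u v → M.sq v w → M.sq u w) ∧
  (∀ w v, w ∈ M.fallible → M.le w v → v ∈ M.fallible) ∧
  (∀ w v, w ∈ M.fallible → M.sq w v → v ∈ M.fallible) ∧
  (∀ p w v, w ∈ M.val p → M.le w v → v ∈ M.val p) ∧
  (∀ p w, w ∈ M.fallible → w ∈ M.val p)

/-- `⊑` is forth–up confluent for `≼`. -/
def ForthUp (M : KModel.{u}) : Prop :=
  ∀ w w' v, M.le w w' → M.sq w v → ∃ v', M.le v v' ∧ M.sq w' v'

/-- `⊑` is back–up confluent for `≼`. -/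
def BackUp (M : KModel.{u}) : Prop :=
  ∀ w v v', M.sq w v → M.le v v' → ∃ w', M.le w w' ∧ M.sq w' v'

/-- `⊑` is forth–down confluent for `≼`. -/
def ForthDown (M : KModel.{u}) : Prop :=
  ∀ w v v', M.le w v → M.sq v v' → ∃ w', M.sq w w' ∧ M.le w' v'

/-- `≼` is upward linear. -/
def UpLinear (M : KModel.{u}) : Prop :=
  ∀ w u v, M.le w u → M.le w v → M.le u v ∨ M.le v u

/-- There are no fallible worlds. -/
def Infallible (M : KModel.{u}) : Prop := M.fallible = ∅

/-- CS4 frames: back–up confluent bi-intuitionistic frames. -/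
def IsCS4 (M : KModel.{u}) : Prop := M.IsBiInt ∧ M.BackUp

/-- IS4 frames: forth–up confluent infallible CS4 frames. -/
def IsIS4 (M : KModel.{u}) : Prop := M.IsCS4 ∧ M.ForthUp ∧ M.Infallible

/-- GS4 frames: upward-linear IS4 frames. -/
def IsGS4 (M : KModel.{u}) : Prop := M.IsIS4 ∧ M.UpLinear

/-- GS4c frames: forth–down confluent GS4 frames. -/
def IsGS4c (M : KModel.{u}) : Prop := M.IsGS4 ∧ M.ForthDown

/-- S4I frames: forth–up and forth–down confluent infallible bi-intuitionistic frames. -/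
def IsS4I (M : KModel.{u}) : Prop :=
  M.IsBiInt ∧ M.ForthUp ∧ M.ForthDown ∧ M.Infallible

end KModel

/-- A numerical encoding of formulas, used to state decidability of validity. -/
def Fml.encode : Fml → ℕ
  | .var n => Nat.pair 0 n
  | .bot => Nat.pair 1 0
  | .and φ ψ => Nat.pair 2 (Nat.pair φ.encode ψ.encode)
  | .or φ ψ => Nat.pair 3 (Nat.pair φ.encode ψ.encode)
  | .imp φ ψ => Nat.pair 4 (Nat.pair φ.encode ψ.encode)
  | .dia φ => Nat.pair 5 φ.encode
  | .box φ => Nat.pair 6 φ.encode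

/-- The (finite) set of subformulas of a formula. -/
def Fml.subfmls : Fml → Finset Fml
  | .var n => {.var n}
  | .bot => {.bot}
  | .and φ ψ => insert (.and φ ψ) (φ.subfmls ∪ ψ.subfmls)
  | .or φ ψ => insert (.or φ ψ) (φ.subfmls ∪ ψ.subfmls)
  | .imp φ ψ => insert (.imp φ ψ) (φ.subfmls ∪ ψ.subfmls)
  | .dia φ => insert (.dia φ) φ.subfmls
  | .box φ => insert (.box φ) φ.subfmls

/-- Validity on the class of GS4 frames. -/
def GS4Valid (φ : Fml) : Prop :=
  ∀ (M : KModel.{u}) (w : M.W), M.IsGS4 → w ∉ M.fallible → M.Sat φ w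

namespace GS4Proof

open KModel

/-! ### Subformulas -/

theorem self_mem (φ : Fml) : φ ∈ φ.subfmls := by
  cases φ <;> simp [Fml.subfmls]

theorem sub_trans (φ : Fml) : ∀ ψ ∈ φ.subfmls, ψ.subfmls ⊆ φ.subfmls := by
  induction φ with
  | var n => intro ψ h; simp [Fml.subfmls] at h; subst h; rfl
  | bot => intro ψ h; simp [Fml.subfmls] at h; subst h; rfl
  | and a b iha ihb | or a b iha ihb | imp a b iha ihb =>
    intro ψ h
    simp only [Fml.subfmls, Finset.mem_insert, Finset.mem_union] at h
    rcases h with h | h | h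
    · subst h; rfl
    · intro x hx
      have := iha ψ h hx
      simp [Fml.subfmls, this]
    · intro x hx
      have := ihb ψ h hx
      simp [Fml.subfmls, this]
  | dia a iha | box a iha =>
    intro ψ h
    simp only [Fml.subfmls, Finset.mem_insert] at h
    rcases h with h | h
    · subst h; rfl
    · intro x hx
      have := iha ψ h hx
      simp [Fml.subfmls, this]

/-! ### Basic facts on models -/

theorem sat_mono {M : KModel.{u}} (h : M.IsBiInt) (ψ : Fml) :
    ∀ w v, M.le w v → M.Sat ψ w → M.Sat ψ v := by
  obtain ⟨_, htr, _, _, hf, _, hv, _⟩ := h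
  induction ψ with
  | var p => intro w v hwv h; exact hv p w v h hwv
  | bot => intro w v hwv h; exact hf w v h hwv
  | and a b iha ihb => intro w v hwv h; exact ⟨iha w v hwv h.1, ihb w v hwv h.2⟩
  | or a b iha ihb =>
    intro w v hwv h
    exact h.imp (iha w v hwv) (ihb w v hwv)
  | imp a b iha ihb => intro w v hwv h x hx; exact h x (htr _ _ _ hwv hx)
  | dia a iha => intro w v hwv h x hx; exact h x (htr _ _ _ hwv hx)
  | box a iha => intro w v hwv h x y hx; exact h x y (htr _ _ _ hwv hx)

theorem sat_dia {M : KModel.{u}} (h : M.IsGS4) (ψ : Fml) (w : M.W) :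
    M.Sat (.dia ψ) w ↔ ∃ v, M.sq w v ∧ M.Sat ψ v := by
  obtain ⟨⟨⟨hb, _⟩, hfu, _⟩, _⟩ := h
  constructor
  · intro h; exact h w (hb.1 w)
  · rintro ⟨v, hv, hs⟩ u hu
    obtain ⟨v', h1, h2⟩ := hfu w u v hu hv
    exact ⟨v', h2, sat_mono hb ψ _ _ h1 hs⟩

theorem dia_back {M : KModel.{u}} (h : M.IsGS4) (ψ : Fml) (w v : M.W) (hwv : M.sq w v)
    (hs : M.Sat (.dia ψ) v) : M.Sat (.dia ψ) w := by
  rw [sat_dia h] at hs ⊢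
  obtain ⟨x, hx, hs⟩ := hs
  exact ⟨x, h.1.1.1.2.2.2.1 _ _ _ hwv hx, hs⟩

theorem box_forth {M : KModel.{u}} (h : M.IsGS4) (ψ : Fml) (w v : M.W) (hwv : M.sq w v)
    (hs : M.Sat (.box ψ) w) : M.Sat (.box ψ) v := by
  intro u x hvu hux
  obtain ⟨w', h1, h2⟩ := h.1.1.2 w v u hwv hvu
  exact hs w' x h1 (h.1.1.1.2.2.2.1 _ _ _ h2 hux)

/-! ### The quotient by chains of types -/

open Classical in
noncomputable def lab (M : KModel.{u}) (S : Finset Fml) (w : M.W) : Finset Fml :=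
  S.filter (fun ψ => M.Sat ψ w)

theorem mem_lab {M : KModel.{u}} {S : Finset Fml} {w : M.W} {ψ : Fml} :
    ψ ∈ lab M S w ↔ ψ ∈ S ∧ M.Sat ψ w := by
  simp [lab]

theorem lab_mono {M : KModel.{u}} (h : M.IsBiInt) {S : Finset Fml} {w v : M.W}
    (hwv : M.le w v) : lab M S w ⊆ lab M S v := by
  intro ψ
  rw [mem_lab, mem_lab]
  exact fun ⟨a, b⟩ => ⟨a, sat_mono h ψ _ _ hwv b⟩

def chn (M : KModel.{u}) (S : Finset Fml) (w : M.W) : Set (Finset Fml) :=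
  {T | ∃ v, M.le w v ∧ lab M S v = T}

theorem lab_mem_chn {M : KModel.{u}} (h : M.IsBiInt) (S : Finset Fml) (w : M.W) :
    lab M S w ∈ chn M S w := ⟨w, h.1 w, rfl⟩

def Q (M : KModel.{u}) (S : Finset Fml) : Type :=
  {C : Set (Finset Fml) // ∃ w, chn M S w = C}

def Q.mk (M : KModel.{u}) (S : Finset Fml) (w : M.W) : Q M S := ⟨chn M S w, w, rfl⟩

theorem Q.ex {M : KModel.{u}} {S : Finset Fml} (c : Q M S) : ∃ w, Q.mk M S w = c := by
  obtain ⟨C, w, h⟩ := c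
  exact ⟨w, Subtype.ext h⟩

def Q.le {M : KModel.{u}} {S : Finset Fml} (c d : Q M S) : Prop :=
  d.1 ⊆ c.1 ∧ ∀ T ∈ c.1, ∀ T' ∈ d.1, T' ⊆ T → T ∈ d.1

def Q.sq0 {M : KModel.{u}} {S : Finset Fml} (c d : Q M S) : Prop :=
  ∃ w v, M.sq w v ∧ Q.mk M S w = c ∧ Q.mk M S v = d

def QM (M : KModel.{u}) (S : Finset Fml) : KModel.{0} where
  W := Q M S
  fallible := ∅
  le := Q.le
  sq := Relation.ReflTransGen Q.sq0
  val := fun p => {c | ∀ T ∈ c.1, Fml.var p ∈ T}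

theorem mk_le {M : KModel.{u}} (h : M.IsGS4) {S : Finset Fml} {w v : M.W} (hwv : M.le w v) :
    Q.le (Q.mk M S w) (Q.mk M S v) := by
  have hb := h.1.1.1
  constructor
  · rintro T ⟨x, hx, rfl⟩
    exact ⟨x, hb.2.1 _ _ _ hwv hx, rfl⟩
  · rintro T ⟨x, hx, rfl⟩ T' ⟨y, hy, rfl⟩ hsub
    rcases h.2 w x v hx hwv with h1 | h1
    · refine ⟨v, hb.1 v, ?_⟩
      refine (Finset.Subset.antisymm (lab_mono hb h1) ?_).symm
      exact (lab_mono hb hy).trans hsub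
    · exact ⟨x, h1, rfl⟩

theorem le_lift {M : KModel.{u}} (h : M.IsGS4) {S : Finset Fml} {w : M.W} {d : Q M S}
    (hd : Q.le (Q.mk M S w) d) : ∃ v, M.le w v ∧ Q.mk M S v = d := by
  have hb := h.1.1.1
  obtain ⟨x, rfl⟩ := Q.ex d
  obtain ⟨v, hwv, hv⟩ := hd.1 (lab_mem_chn hb S x)
  refine ⟨v, hwv, Subtype.ext ?_⟩
  have hd' := mk_le h (S := S) hwv
  apply Set.Subset.antisymm
  · rintro T ⟨y, hy, rfl⟩
    refine hd.2 _ ⟨y, hb.2.1 _ _ _ hwv hy, rfl⟩ _ (lab_mem_chn hb S x) ?_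
    rw [← hv]; exact lab_mono hb hy
  · intro T hT
    refine hd'.2 T (hd.1 hT) _ (lab_mem_chn hb S v) ?_
    rw [hv]
    obtain ⟨y, hy, rfl⟩ := hT
    exact lab_mono hb hy

theorem lab_eq {M : KModel.{u}} (hb : M.IsBiInt) {S : Finset Fml} {w v : M.W}
    (h : Q.mk M S w = Q.mk M S v) : lab M S w = lab M S v := by
  have h : chn M S w = chn M S v := congrArg Subtype.val h
  obtain ⟨x, hx, e⟩ : lab M S w ∈ chn M S v := h ▸ lab_mem_chn hb S w
  obtain ⟨y, hy, e'⟩ : lab M S v ∈ chn M S w := h ▸ lab_mem_chn hb S v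
  apply Finset.Subset.antisymm
  · rw [← e']; exact lab_mono hb hy
  · rw [← e]; exact lab_mono hb hx

theorem Q.le_trans {M : KModel.{u}} {S : Finset Fml} {a b c : Q M S} (h : Q.le a b)
    (h' : Q.le b c) : Q.le a c :=
  ⟨h'.1.trans h.1, fun T hT T' hT' hs => h'.2 T (h.2 T hT T' (h'.1 hT') hs) T' hT' hs⟩

theorem QM_gs4 {M : KModel.{u}} (h : M.IsGS4) (S : Finset Fml) : (QM M S).IsGS4 := by
  have hb := h.1.1.1
  refine ⟨⟨⟨⟨?_, ?_, ?_, ?_, ?_, ?_, ?_, ?_⟩, ?_⟩, ?_, rfl⟩, ?_⟩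
  · intro w; exact ⟨subset_rfl, fun T hT _ _ _ => hT⟩
  · intro u v w h h'; exact Q.le_trans h h'
  · intro w; exact Relation.ReflTransGen.refl
  · intro u v w h h'; exact Relation.ReflTransGen.trans h h'
  · intro w v h; exact h.elim
  · intro w v h; exact h.elim
  · intro p w v hw hwv T hT; exact hw T (hwv.1 hT)
  · intro p w h; exact h.elim
  · intro w v v' hwv
    change Q M S at v'
    change Relation.ReflTransGen Q.sq0 w v at hwv
    intro hv
    change Q.le v v' at hv
    induction hwv using Relation.ReflTransGen.head_induction_on with
    | refl => exact ⟨v', hv, Relation.ReflTransGen.refl⟩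
    | head hac _ ih =>
      obtain ⟨c', hc, hc'⟩ := ih
      obtain ⟨x, y, hxy, rfl, rfl⟩ := hac
      obtain ⟨y', hy, rfl⟩ := le_lift h hc
      obtain ⟨x', hx, hx'⟩ := h.1.1.2 x y y' hxy hy
      exact ⟨Q.mk M S x', mk_le h hx, Relation.ReflTransGen.head ⟨x', y', hx', rfl, rfl⟩ hc'⟩
  · intro w w' v hw hwv
    change Q M S at w'
    change Relation.ReflTransGen Q.sq0 w v at hwv
    change Q.le w w' at hw
    induction hwv with
    | refl => exact ⟨w', hw, Relation.ReflTransGen.refl⟩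
    | tail _ hac ih =>
      obtain ⟨c', hc, hc'⟩ := ih
      obtain ⟨x, y, hxy, rfl, rfl⟩ := hac
      obtain ⟨x', hx, rfl⟩ := le_lift h hc
      obtain ⟨y', hy, hy'⟩ := h.1.2.1 x x' y hx hxy
      exact ⟨Q.mk M S y', mk_le h hy, Relation.ReflTransGen.tail hc' ⟨x', y', hy', rfl, rfl⟩⟩
  · intro w a b ha hb'
    obtain ⟨x, rfl⟩ := Q.ex w
    obtain ⟨y, hy, rfl⟩ := le_lift h ha
    obtain ⟨z, hz, rfl⟩ := le_lift h hb'
    exact (h.2 x y z hy hz).imp (mk_le h) (mk_le h)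

theorem sq_dia {M : KModel.{u}} (h : M.IsGS4) {S : Finset Fml} {ψ : Fml}
    (hψ : Fml.dia ψ ∈ S) {c d : Q M S} (hcd : Relation.ReflTransGen Q.sq0 c d) :
    ∀ v, Q.mk M S v = d → M.Sat (.dia ψ) v → ∀ w, Q.mk M S w = c → M.Sat (.dia ψ) w := by
  have hb := h.1.1.1
  intro v hv hs
  induction hcd using Relation.ReflTransGen.head_induction_on with
  | refl =>
    intro w hw
    have := lab_eq hb (hv.trans hw.symm)
    have h1 : Fml.dia ψ ∈ lab M S v := mem_lab.2 ⟨hψ, hs⟩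
    rw [this] at h1
    exact (mem_lab.1 h1).2
  | head hac _ ih =>
    obtain ⟨x, y, hxy, rfl, rfl⟩ := hac
    intro w hw
    have h1 : Fml.dia ψ ∈ lab M S x := mem_lab.2 ⟨hψ, dia_back h ψ x y hxy (ih y rfl)⟩
    rw [← lab_eq hb hw] at h1
    exact (mem_lab.1 h1).2

theorem sq_box {M : KModel.{u}} (h : M.IsGS4) {S : Finset Fml} {ψ : Fml}
    (hψ : Fml.box ψ ∈ S) {c d : Q M S} (hcd : Relation.ReflTransGen Q.sq0 c d) :
    ∀ w, Q.mk M S w = c → M.Sat (.box ψ) w → ∀ v, Q.mk M S v = d → M.Sat (.box ψ) v := by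
  have hb := h.1.1.1
  intro v hv hs
  induction hcd with
  | refl =>
    intro w hw
    have := lab_eq hb (hv.trans hw.symm)
    have h1 : Fml.box ψ ∈ lab M S v := mem_lab.2 ⟨hψ, hs⟩
    rw [this] at h1
    exact (mem_lab.1 h1).2
  | tail _ hac ih =>
    obtain ⟨x, y, hxy, rfl, rfl⟩ := hac
    intro w hw
    have h1 : Fml.box ψ ∈ lab M S y := mem_lab.2 ⟨hψ, box_forth h ψ x y hxy (ih x rfl)⟩
    rw [← lab_eq hb hw] at h1
    exact (mem_lab.1 h1).2

theorem truth {M : KModel.{u}} (h : M.IsGS4) (S : Finset Fml) (ψ : Fml) :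
    ψ.subfmls ⊆ S → ∀ w, (QM M S).Sat ψ (Q.mk M S w) ↔ M.Sat ψ w := by
  have hb := h.1.1.1
  induction ψ with
  | var p =>
    intro hS w
    have hp : Fml.var p ∈ S := hS (self_mem _)
    constructor
    · intro hw
      exact (mem_lab.1 (hw _ (lab_mem_chn hb S w))).2
    · rintro hw T ⟨v, hv, rfl⟩
      exact mem_lab.2 ⟨hp, sat_mono hb _ _ _ hv hw⟩
  | bot =>
    intro hS w
    have : M.fallible = ∅ := h.1.2.2
    constructor
    · intro hw; exact hw.elim
    · intro hw
      have hw : w ∈ M.fallible := hw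
      rw [this] at hw; exact hw.elim
  | and a b iha ihb =>
    intro hS w
    simp only [KModel.Sat]
    rw [iha (fun x hx => hS (by simp [Fml.subfmls, hx])),
      ihb (fun x hx => hS (by simp [Fml.subfmls, hx]))]
  | or a b iha ihb =>
    intro hS w
    simp only [KModel.Sat]
    rw [iha (fun x hx => hS (by simp [Fml.subfmls, hx])),
      ihb (fun x hx => hS (by simp [Fml.subfmls, hx]))]
  | imp a b iha ihb =>
    intro hS w
    replace iha := iha (fun x hx => hS (by simp [Fml.subfmls, hx]))
    replace ihb := ihb (fun x hx => hS (by simp [Fml.subfmls, hx]))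
    constructor
    · intro hw v hv hs
      exact (ihb v).1 (hw (Q.mk M S v) (mk_le h hv) ((iha v).2 hs))
    · intro hw d hd hs
      obtain ⟨v, hv, rfl⟩ := le_lift h hd
      exact (ihb v).2 (hw v hv ((iha v).1 hs))
  | dia a iha =>
    intro hS w
    replace iha := iha (fun x hx => hS (by simp [Fml.subfmls, hx]))
    have hp : Fml.dia a ∈ S := hS (self_mem _)
    refine (sat_dia (QM_gs4 h S) a (Q.mk M S w)).trans ?_
    constructor
    · rintro ⟨d, hd, hs⟩
      obtain ⟨v, rfl⟩ := Q.ex d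
      refine sq_dia h hp hd v rfl ?_ w rfl
      rw [sat_dia h]
      exact ⟨v, hb.2.2.1 v, (iha v).1 hs⟩
    · rw [sat_dia h]
      rintro ⟨v, hv, hs⟩
      exact ⟨Q.mk M S v, Relation.ReflTransGen.single ⟨w, v, hv, rfl, rfl⟩, (iha v).2 hs⟩
  | box a iha =>
    intro hS w
    replace iha := iha (fun x hx => hS (by simp [Fml.subfmls, hx]))
    have hp : Fml.box a ∈ S := hS (self_mem _)
    constructor
    · intro hw u v hu hv
      exact (iha v).1 (hw (Q.mk M S u) (Q.mk M S v) (mk_le h hu)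
        (Relation.ReflTransGen.single ⟨u, v, hv, rfl, rfl⟩))
    · intro hw d e hd he
      obtain ⟨u, hu, rfl⟩ := le_lift h hd
      obtain ⟨v, rfl⟩ := Q.ex e
      have h1 := sq_box h hp he u rfl (sat_mono hb _ _ _ hu hw) v rfl
      exact (iha v).2 (h1 v v (hb.1 v) (hb.2.2.1 v))

/-! ### Counting -/

theorem chn_range {M : KModel.{u}} (h : M.IsGS4) (S : Finset Fml) (w : M.W) :
    ∃ f : Fin (S.card + 1) → S.powerset,
      chn M S w = Set.range (fun i => (f i : Finset Fml)) := by
  classical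
  have hb := h.1.1.1
  have hpow : ∀ v, lab M S v ∈ S.powerset := fun v =>
    Finset.mem_powerset.2 fun ψ hψ => (mem_lab.1 hψ).1
  let f : Fin (S.card + 1) → S.powerset := fun i =>
    if hi : ∃ v, M.le w v ∧ (lab M S v).card = i then ⟨lab M S hi.choose, hpow _⟩
    else ⟨lab M S w, hpow w⟩
  refine ⟨f, Set.Subset.antisymm ?_ ?_⟩
  · rintro T ⟨v, hv, rfl⟩
    have hlt : (lab M S v).card < S.card + 1 :=
      Nat.lt_succ_of_le (Finset.card_le_card (Finset.mem_powerset.1 (hpow v)))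
    refine ⟨⟨(lab M S v).card, hlt⟩, ?_⟩
    have hi : ∃ x, M.le w x ∧ (lab M S x).card = (lab M S v).card := ⟨v, hv, rfl⟩
    simp only [f, hi, dite_true]
    obtain ⟨h1, h2⟩ := hi.choose_spec
    rcases h.2 w _ v h1 hv with h3 | h3
    · exact Finset.eq_of_subset_of_card_le (lab_mono hb h3) h2.ge
    · exact (Finset.eq_of_subset_of_card_le (lab_mono hb h3) h2.le).symm
  · rintro T ⟨i, rfl⟩
    by_cases hi : ∃ v, M.le w v ∧ (lab M S v).card = i
    · simp only [f, hi, dite_true]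
      exact ⟨_, hi.choose_spec.1, rfl⟩
    · simp only [f, hi, dite_false]
      exact lab_mem_chn hb S w

theorem Q_card {M : KModel.{u}} (h : M.IsGS4) (S : Finset Fml) :
    Finite (Q M S) ∧ Nat.card (Q M S) ≤ 2 ^ (S.card * (S.card + 1)) := by
  classical
  have hex : ∀ c : Q M S, ∃ f : Fin (S.card + 1) → S.powerset,
      c.1 = Set.range (fun i => (f i : Finset Fml)) := by
    intro c
    obtain ⟨w, rfl⟩ := Q.ex c
    exact chn_range h S w
  choose F hF using hex
  have hinj : Function.Injective F := by
    intro c d hcd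
    apply Subtype.ext
    rw [hF c, hF d, hcd]
  refine ⟨Finite.of_injective F hinj, ?_⟩
  have := Nat.card_le_card_of_injective F hinj
  refine this.trans_eq ?_
  rw [Nat.card_fun, Nat.card_eq_fintype_card, Fintype.card_coe, Finset.card_powerset,
    Nat.card_eq_fintype_card, Fintype.card_fin, pow_mul]

/-! ### Lifting universes -/

def lift (N : KModel.{0}) : KModel.{u} where
  W := ULift.{u} N.W
  fallible := {w | w.down ∈ N.fallible}
  le := fun a b => N.le a.down b.down
  sq := fun a b => N.sq a.down b.down
  val := fun p => {w | w.down ∈ N.val p}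

theorem lift_gs4 {N : KModel.{0}} (h : N.IsGS4) : (lift.{u} N).IsGS4 := by
  obtain ⟨⟨⟨⟨h1, h2, h3, h4, h5, h6, h7, h8⟩, h9⟩, h10, h11⟩, h12⟩ := h
  refine ⟨⟨⟨⟨fun w => h1 _, fun _ _ _ => h2 _ _ _, fun _ => h3 _, fun _ _ _ => h4 _ _ _,
    fun _ _ => h5 _ _, fun _ _ => h6 _ _, fun _ _ _ => h7 _ _ _, fun _ _ => h8 _ _⟩, ?_⟩,
    ?_, ?_⟩, fun _ _ _ => h12 _ _ _⟩
  · intro w v v' a b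
    obtain ⟨x, hx⟩ := h9 _ _ _ a b
    exact ⟨⟨x⟩, hx⟩
  · intro w v v' a b
    obtain ⟨x, hx⟩ := h10 _ _ _ a b
    exact ⟨⟨x⟩, hx⟩
  · have : N.fallible = ∅ := h11
    apply Set.eq_empty_of_forall_notMem
    intro w hw
    have hw : w.down ∈ N.fallible := hw
    rw [this] at hw; exact hw.elim

theorem lift_sat (N : KModel.{0}) (ψ : Fml) :
    ∀ w : N.W, (lift.{u} N).Sat ψ ⟨w⟩ ↔ N.Sat ψ w := by
  induction ψ with
  | var p => intro w; rfl
  | bot => intro w; rfl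
  | and a b iha ihb => intro w; simp only [KModel.Sat, iha, ihb]
  | or a b iha ihb => intro w; simp only [KModel.Sat, iha, ihb]
  | imp a b iha ihb =>
    intro w
    exact ⟨fun h v hv hs => (ihb v).1 (h ⟨v⟩ hv ((iha v).2 hs)),
      fun h v hv hs => (ihb v.down).2 (h v.down hv ((iha v.down).1 hs))⟩
  | dia a iha =>
    intro w
    constructor
    · intro h v hv
      obtain ⟨x, hx, hs⟩ := h ⟨v⟩ hv
      exact ⟨x.down, hx, (iha x.down).1 hs⟩
    · intro h v hv
      obtain ⟨x, hx, hs⟩ := h v.down hv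
      exact ⟨⟨x⟩, hx, (iha x).2 hs⟩
  | box a iha =>
    intro w
    exact ⟨fun h u v hu hv => (iha v).1 (h ⟨u⟩ ⟨v⟩ hu hv),
      fun h u v hu hv => (iha v.down).2 (h u.down v.down hu hv)⟩

theorem fmp (φ : Fml) :
      (∃ (M : KModel.{u}) (w : M.W), M.IsGS4 ∧ w ∉ M.fallible ∧ ¬ M.Sat φ w) ↔
      (∃ (N : KModel.{0}) (v : N.W), N.IsGS4 ∧ Finite N.W ∧
        Nat.card N.W ≤ (φ.subfmls.card + 1) *
          2 ^ (φ.subfmls.card * (φ.subfmls.card + 1) + 1) ∧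
        v ∉ N.fallible ∧ ¬ N.Sat φ v) := by
  constructor
  · rintro ⟨M, w, hM, _, hs⟩
    obtain ⟨h1, h2⟩ := Q_card hM φ.subfmls
    refine ⟨QM M φ.subfmls, Q.mk M φ.subfmls w, QM_gs4 hM _, h1, ?_, fun h => h.elim, ?_⟩
    · refine h2.trans ?_
      calc _ ≤ 2 ^ (φ.subfmls.card * (φ.subfmls.card + 1) + 1) :=
            Nat.pow_le_pow_right (by norm_num) (Nat.le_succ _)
        _ ≤ _ := Nat.le_mul_of_pos_left _ (Nat.succ_pos _)
    · rwa [truth hM _ φ (Finset.Subset.refl _)]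
  · rintro ⟨N, v, hN, _, _, hv, hs⟩
    exact ⟨lift N, ⟨v⟩, lift_gs4 hN, hv, by rwa [lift_sat]⟩

/-! ### Bounded arithmetic formulas are primitive recursive -/

inductive Tm : Type where
  | v : ℕ → Tm
  | c : ℕ → Tm
  | plus : Tm → Tm → Tm
  | times : Tm → Tm → Tm
  | two : Tm → Tm
  | p1 : Tm → Tm
  | p2 : Tm → Tm

def Tm.ev : Tm → List ℕ → ℕ
  | .v i, e => e.getD i 0
  | .c n, _ => n
  | .plus s t, e => s.ev e + t.ev e
  | .times s t, e => s.ev e * t.ev e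
  | .two s, e => 2 ^ s.ev e
  | .p1 s, e => (s.ev e).unpair.1
  | .p2 s, e => (s.ev e).unpair.2

def bit (a i : ℕ) : Prop := a / 2 ^ i % 2 = 1

inductive BF : Type where
  | eq : Tm → Tm → BF
  | bt : Tm → Tm → BF
  | and : BF → BF → BF
  | or : BF → BF → BF
  | imp : BF → BF → BF
  | iff : BF → BF → BF
  | not : BF → BF
  | all : Tm → BF → BF
  | ex : Tm → BF → BF

def BF.ev : BF → List ℕ → Prop
  | .eq s t, e => s.ev e = t.ev e
  | .bt s t, e => bit (s.ev e) (t.ev e)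
  | .and a b, e => a.ev e ∧ b.ev e
  | .or a b, e => a.ev e ∨ b.ev e
  | .imp a b, e => a.ev e → b.ev e
  | .iff a b, e => a.ev e ↔ b.ev e
  | .not a, e => ¬ a.ev e
  | .all t a, e => ∀ x < t.ev e, a.ev (x :: e)
  | .ex t a, e => ∃ x < t.ev e, a.ev (x :: e)

theorem primrec_two : Primrec (fun n : ℕ => 2 ^ n) := by
  have : Primrec₂ (fun (_ : ℕ) (p : ℕ × ℕ) => 2 * p.2) :=
    (Primrec.nat_mul.comp (Primrec.const 2) (Primrec.snd.comp Primrec.snd))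
  refine (Primrec.nat_rec' Primrec.id (Primrec.const 1) this).of_eq ?_
  intro n
  simp only [id]
  induction n with
  | zero => rfl
  | succ n ih => simp only [ih, pow_succ]; ring

theorem Tm.primrec (t : Tm) : Primrec t.ev := by
  induction t with
  | v i => exact (Primrec.list_getD 0).comp Primrec.id (Primrec.const i)
  | c n => exact Primrec.const n
  | plus s t hs ht => exact Primrec.nat_add.comp hs ht
  | times s t hs ht => exact Primrec.nat_mul.comp hs ht
  | two s hs => exact primrec_two.comp hs
  | p1 s hs => exact Primrec.fst.comp (Primrec.unpair.comp hs)
  | p2 s hs => exact Primrec.snd.comp (Primrec.unpair.comp hs)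

theorem BF.primrec (a : BF) : PrimrecPred a.ev := by
  induction a with
  | eq s t => exact Primrec.eq.comp s.primrec t.primrec
  | bt s t =>
    exact Primrec.eq.comp (Primrec.nat_mod.comp (Primrec.nat_div.comp s.primrec
      (primrec_two.comp t.primrec)) (Primrec.const 2)) (Primrec.const 1)
  | and a b ha hb => exact ha.and hb
  | or a b ha hb => exact ha.or hb
  | imp a b ha hb => exact (ha.not.or hb).of_eq fun e => by simp only [BF.ev]; tauto
  | iff a b ha hb =>
    exact ((ha.and hb).or (ha.not.and hb.not)).of_eq fun e => by simp only [BF.ev]; tauto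
  | not a ha => exact ha.not
  | all t a ha =>
    have h1 : PrimrecRel (fun (x : ℕ) (e : List ℕ) => a.ev (x :: e)) :=
      ha.comp (Primrec.list_cons.comp Primrec.fst Primrec.snd)
    exact (h1.forall_mem_list.comp (Primrec.list_range.comp t.primrec) Primrec.id).of_eq
      fun e => by simp [BF.ev]
  | ex t a ha =>
    have h1 : PrimrecRel (fun (x : ℕ) (e : List ℕ) => a.ev (x :: e)) :=
      ha.comp (Primrec.list_cons.comp Primrec.fst Primrec.snd)
    exact (h1.exists_mem_list.comp (Primrec.list_range.comp t.primrec) Primrec.id).of_eq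
      fun e => by simp [BF.ev]

/-! ### The finite search -/

def Loc (k : ℕ) (le sq T : ℕ → ℕ → Prop) (c x : ℕ) : Prop :=
  (c.unpair.1 = 0 → ∀ y < k, le x y → T c x → T c y) ∧
  (c.unpair.1 = 1 → ¬ T c x) ∧
  (c.unpair.1 = 2 → (T c x ↔ T c.unpair.2.unpair.1 x ∧ T c.unpair.2.unpair.2 x)) ∧
  (c.unpair.1 = 3 → (T c x ↔ T c.unpair.2.unpair.1 x ∨ T c.unpair.2.unpair.2 x)) ∧
  (c.unpair.1 = 4 → (T c x ↔
    ∀ y < k, le x y → T c.unpair.2.unpair.1 y → T c.unpair.2.unpair.2 y)) ∧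
  (c.unpair.1 = 5 → (T c x ↔ ∀ y < k, le x y → ∃ z < k, sq y z ∧ T c.unpair.2 z)) ∧
  (c.unpair.1 = 6 → (T c x ↔ ∀ y < k, le x y → ∀ z < k, sq y z → T c.unpair.2 z))

structure Spec (n k : ℕ) (le sq T : ℕ → ℕ → Prop) : Prop where
  lr : ∀ x < k, le x x
  lt : ∀ x < k, ∀ y < k, ∀ z < k, le x y → le y z → le x z
  sr : ∀ x < k, sq x x
  st : ∀ x < k, ∀ y < k, ∀ z < k, sq x y → sq y z → sq x z
  bu : ∀ x < k, ∀ y < k, ∀ z < k, sq x y → le y z → ∃ w < k, le x w ∧ sq w z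
  fu : ∀ x < k, ∀ y < k, ∀ z < k, le x y → sq x z → ∃ w < k, le z w ∧ sq y w
  ul : ∀ x < k, ∀ y < k, ∀ z < k, le x y → le x z → le y z ∨ le z y
  loc : ∀ c < n + 1, ∀ x < k, Loc k le sq T c x
  fals : ∃ x < k, ¬ T n x

/- Environment below `d` extra variables: `t, b, a, k, n`. -/
def leF (d : ℕ) (x y : Tm) : BF := .bt (.v (d + 2)) (.plus (.times x (.v (d + 3))) y)
def sqF (d : ℕ) (x y : Tm) : BF := .bt (.v (d + 1)) (.plus (.times x (.v (d + 3))) y)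
def TF (d : ℕ) (x y : Tm) : BF := .bt (.v d) (.plus (.times x (.v (d + 3))) y)

def all3 (f : BF) : BF := .all (.v 3) (.all (.v 4) (.all (.v 5) f))

/- In the scope of `x, c`. -/
def locF : BF :=
  let tag (i : ℕ) : BF := .eq (.p1 (.v 1)) (.c i)
  .and (.imp (tag 0) (.all (.v 5) (.imp (leF 3 (.v 1) (.v 0))
    (.imp (TF 3 (.v 2) (.v 1)) (TF 3 (.v 2) (.v 0)))))) <|
  .and (.imp (tag 1) (.not (TF 2 (.v 1) (.v 0)))) <|
  .and (.imp (tag 2) (.iff (TF 2 (.v 1) (.v 0))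
    (.and (TF 2 (.p1 (.p2 (.v 1))) (.v 0)) (TF 2 (.p2 (.p2 (.v 1))) (.v 0))))) <|
  .and (.imp (tag 3) (.iff (TF 2 (.v 1) (.v 0))
    (.or (TF 2 (.p1 (.p2 (.v 1))) (.v 0)) (TF 2 (.p2 (.p2 (.v 1))) (.v 0))))) <|
  .and (.imp (tag 4) (.iff (TF 2 (.v 1) (.v 0)) (.all (.v 5) (.imp (leF 3 (.v 1) (.v 0))
    (.imp (TF 3 (.p1 (.p2 (.v 2))) (.v 0)) (TF 3 (.p2 (.p2 (.v 2))) (.v 0))))))) <|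
  .and (.imp (tag 5) (.iff (TF 2 (.v 1) (.v 0)) (.all (.v 5) (.imp (leF 3 (.v 1) (.v 0))
    (.ex (.v 6) (.and (sqF 4 (.v 1) (.v 0)) (TF 4 (.p2 (.v 3)) (.v 0)))))))) <|
  .imp (tag 6) (.iff (TF 2 (.v 1) (.v 0)) (.all (.v 5) (.imp (leF 3 (.v 1) (.v 0))
    (.all (.v 6) (.imp (sqF 4 (.v 1) (.v 0)) (TF 4 (.p2 (.v 3)) (.v 0)))))))

def specF : BF :=
  .and (.all (.v 3) (leF 1 (.v 0) (.v 0))) <|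
  .and (all3 (.imp (leF 3 (.v 2) (.v 1)) (.imp (leF 3 (.v 1) (.v 0)) (leF 3 (.v 2) (.v 0))))) <|
  .and (.all (.v 3) (sqF 1 (.v 0) (.v 0))) <|
  .and (all3 (.imp (sqF 3 (.v 2) (.v 1)) (.imp (sqF 3 (.v 1) (.v 0)) (sqF 3 (.v 2) (.v 0))))) <|
  .and (all3 (.imp (sqF 3 (.v 2) (.v 1)) (.imp (leF 3 (.v 1) (.v 0))
    (.ex (.v 6) (.and (leF 4 (.v 3) (.v 0)) (sqF 4 (.v 0) (.v 1))))))) <|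
  .and (all3 (.imp (leF 3 (.v 2) (.v 1)) (.imp (sqF 3 (.v 2) (.v 0))
    (.ex (.v 6) (.and (leF 4 (.v 1) (.v 0)) (sqF 4 (.v 2) (.v 0))))))) <|
  .and (all3 (.imp (leF 3 (.v 2) (.v 1)) (.imp (leF 3 (.v 2) (.v 0))
    (.or (leF 3 (.v 1) (.v 0)) (leF 3 (.v 0) (.v 1)))))) <|
  .and (.all (.plus (.v 4) (.c 1)) (.all (.v 4) locF)) <|
  .ex (.v 3) (.not (TF 1 (.v 5) (.v 0)))

def tab (k a x y : ℕ) : Prop := bit a (x * k + y)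

theorem locF_ev (t b a k n c x : ℕ) :
    locF.ev [x, c, t, b, a, k, n] ↔ Loc k (tab k a) (tab k b) (tab k t) c x := Iff.rfl

theorem specF_ev (t b a k n : ℕ) :
    specF.ev [t, b, a, k, n] ↔ Spec n k (tab k a) (tab k b) (tab k t) := by
  constructor
  · rintro ⟨h1, h2, h3, h4, h5, h6, h7, h8, h9⟩
    exact ⟨h1, h2, h3, h4, h5, h6, h7, h8, h9⟩
  · rintro ⟨h1, h2, h3, h4, h5, h6, h7, h8, h9⟩
    exact ⟨h1, h2, h3, h4, h5, h6, h7, h8, h9⟩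

def bnd (n : ℕ) : ℕ := (n + 1 + 1) * 2 ^ ((n + 1) * (n + 1 + 1) + 1) + 1

/- Environment: `n`. -/
def mainF : BF :=
  let n1 : Tm := .plus (.v 0) (.c 1)
  let n2 : Tm := .plus n1 (.c 1)
  .ex (.plus (.times n2 (.two (.plus (.times n1 n2) (.c 1)))) (.c 1)) <|
  .ex (.two (.times (.v 0) (.v 0))) <|
  .ex (.two (.times (.v 1) (.v 1))) <|
  .ex (.two (.times (.plus (.v 3) (.c 1)) (.v 2))) specF

theorem mainF_ev (n : ℕ) : mainF.ev [n] ↔ ∃ k < bnd n, ∃ a < 2 ^ (k * k), ∃ b < 2 ^ (k * k),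
    ∃ t < 2 ^ ((n + 1) * k), Spec n k (tab k a) (tab k b) (tab k t) := by
  simp only [← specF_ev]
  exact Iff.rfl

theorem exists_bits (P : ℕ → Prop) (m : ℕ) : ∃ a < 2 ^ m, ∀ i < m, (bit a i ↔ P i) := by
  classical
  refine ⟨Nat.ofBits (fun i : Fin m => decide (P i)), Nat.ofBits_lt_two_pow _, ?_⟩
  intro i hi
  have := Nat.testBit_ofBits_lt (fun i : Fin m => decide (P i)) i hi
  rw [Nat.testBit_eq_decide_div_mod_eq] at this
  simpa [bit] using this

theorem exists_tab (R : ℕ → ℕ → Prop) (m k : ℕ) :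
    ∃ a < 2 ^ (m * k), ∀ x < m, ∀ y < k, (tab k a x y ↔ R x y) := by
  obtain ⟨a, ha, h⟩ := exists_bits (fun i => R (i / k) (i % k)) (m * k)
  refine ⟨a, ha, fun x hx y hy => ?_⟩
  have hlt : x * k + y < m * k := by nlinarith
  have hk : 0 < k := by omega
  have h1 : (x * k + y) / k = x := by
    rw [Nat.add_comm, Nat.add_mul_div_right _ _ hk, Nat.div_eq_of_lt hy, Nat.zero_add]
  have h2 : (x * k + y) % k = y := by
    rw [Nat.add_comm, Nat.add_mul_mod_self_right, Nat.mod_eq_of_lt hy]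
  have := h _ hlt
  rw [h1, h2] at this
  exact this

/-! ### From a table to a model -/

def TM (n k : ℕ) (le sq T : ℕ → ℕ → Prop) : KModel.{0} where
  W := Fin k
  fallible := ∅
  le := fun x y => le x y
  sq := fun x y => sq x y
  val := fun p => {x | Nat.pair 0 p < n + 1 ∧ T (Nat.pair 0 p) x}

theorem TM_gs4 {n k : ℕ} {le sq T : ℕ → ℕ → Prop} (h : Spec n k le sq T) :
    (TM n k le sq T).IsGS4 := by
  refine ⟨⟨⟨⟨?_, ?_, ?_, ?_, ?_, ?_, ?_, ?_⟩, ?_⟩, ?_, rfl⟩, ?_⟩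
  · intro x; exact h.lr _ x.2
  · intro x y z; exact h.lt _ x.2 _ y.2 _ z.2
  · intro x; exact h.sr _ x.2
  · intro x y z; exact h.st _ x.2 _ y.2 _ z.2
  · intro w v h; exact h.elim
  · intro w v h; exact h.elim
  · rintro p w v ⟨hw, hw'⟩ hwv
    exact ⟨hw, (h.loc _ hw _ w.2).1 (by simp) _ v.2 hwv hw'⟩
  · intro p w h; exact h.elim
  · intro x y z a b
    obtain ⟨w, hw, h'⟩ := h.bu _ x.2 _ y.2 _ z.2 a b
    exact ⟨⟨w, hw⟩, h'⟩
  · intro x y z a b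
    obtain ⟨w, hw, h'⟩ := h.fu _ x.2 _ y.2 _ z.2 a b
    exact ⟨⟨w, hw⟩, h'⟩
  · intro x y z; exact h.ul _ x.2 _ y.2 _ z.2

theorem pair_lt_left (i a b : ℕ) : a ≤ Nat.pair i (Nat.pair a b) :=
  (Nat.left_le_pair a b).trans (Nat.right_le_pair i _)

theorem pair_lt_right (i a b : ℕ) : b ≤ Nat.pair i (Nat.pair a b) :=
  (Nat.right_le_pair a b).trans (Nat.right_le_pair i _)

theorem TM_truth {n k : ℕ} {le sq T : ℕ → ℕ → Prop} (h : Spec n k le sq T) (ψ : Fml) :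
    ψ.encode < n + 1 → ∀ x : Fin k, (TM n k le sq T).Sat ψ x ↔ T ψ.encode x := by
  induction ψ with
  | var p => intro hn x; exact ⟨fun h => h.2, fun h => ⟨hn, h⟩⟩
  | bot =>
    intro hn x
    have := (h.loc _ hn _ x.2).2.1 (by simp [Fml.encode])
    exact ⟨fun h => h.elim, fun h => (this h).elim⟩
  | and a b iha ihb =>
    intro hn x
    have := (h.loc _ hn _ x.2).2.2.1 (by simp [Fml.encode])
    simp only [Fml.encode] at hn
    rw [this]
    simp only [Fml.encode, Nat.unpair_pair]
    exact and_congr (iha ((pair_lt_left _ _ _).trans_lt hn) x)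
      (ihb ((pair_lt_right _ _ _).trans_lt hn) x)
  | or a b iha ihb =>
    intro hn x
    have := (h.loc _ hn _ x.2).2.2.2.1 (by simp [Fml.encode])
    simp only [Fml.encode] at hn
    rw [this]
    simp only [Fml.encode, Nat.unpair_pair]
    exact or_congr (iha ((pair_lt_left _ _ _).trans_lt hn) x)
      (ihb ((pair_lt_right _ _ _).trans_lt hn) x)
  | imp a b iha ihb =>
    intro hn x
    have := (h.loc _ hn _ x.2).2.2.2.2.1 (by simp [Fml.encode])
    simp only [Fml.encode] at hn
    rw [this]
    simp only [Fml.encode, Nat.unpair_pair]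
    replace iha := iha ((pair_lt_left _ _ _).trans_lt hn)
    replace ihb := ihb ((pair_lt_right _ _ _).trans_lt hn)
    exact ⟨fun H y hy hxy hs => (ihb ⟨y, hy⟩).1 (H ⟨y, hy⟩ hxy ((iha ⟨y, hy⟩).2 hs)),
      fun H (y : Fin k) hxy hs => (ihb y).2 (H y y.2 hxy ((iha y).1 hs))⟩
  | dia a iha =>
    intro hn x
    have := (h.loc _ hn _ x.2).2.2.2.2.2.1 (by simp [Fml.encode])
    simp only [Fml.encode] at hn
    rw [this]
    simp only [Fml.encode, Nat.unpair_pair]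
    replace iha := iha ((Nat.right_le_pair _ _).trans_lt hn)
    constructor
    · intro H y hy hxy
      obtain ⟨z, hz, hs⟩ := H ⟨y, hy⟩ hxy
      change Fin k at z
      exact ⟨z, z.2, hz, (iha z).1 hs⟩
    · intro H y hxy
      change Fin k at y
      obtain ⟨z, hz, hyz, hs⟩ := H y y.2 hxy
      exact ⟨⟨z, hz⟩, hyz, (iha ⟨z, hz⟩).2 hs⟩
  | box a iha =>
    intro hn x
    have := (h.loc _ hn _ x.2).2.2.2.2.2.2 (by simp [Fml.encode])
    simp only [Fml.encode] at hn
    rw [this]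
    simp only [Fml.encode, Nat.unpair_pair]
    replace iha := iha ((Nat.right_le_pair _ _).trans_lt hn)
    exact ⟨fun H y hy hxy z hz hyz => (iha ⟨z, hz⟩).1 (H ⟨y, hy⟩ ⟨z, hz⟩ hxy hyz),
      fun H (y z : Fin k) hxy hyz => (iha z).2 (H y y.2 hxy z z.2 hyz)⟩

/-! ### From a finite model to a table -/

theorem unpair_snd_lt {c : ℕ} (h : c.unpair.1 ≠ 0) : c.unpair.2 < c := by
  have := Nat.unpair_add_le c
  omega

def dec (c : ℕ) : Fml :=
  if h0 : c.unpair.1 = 0 then .var c.unpair.2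
  else
    have := unpair_snd_lt h0
    have h1 := Nat.unpair_left_le c.unpair.2
    have h2 := Nat.unpair_right_le c.unpair.2
    if c.unpair.1 = 2 then .and (dec c.unpair.2.unpair.1) (dec c.unpair.2.unpair.2)
    else if c.unpair.1 = 3 then .or (dec c.unpair.2.unpair.1) (dec c.unpair.2.unpair.2)
    else if c.unpair.1 = 4 then .imp (dec c.unpair.2.unpair.1) (dec c.unpair.2.unpair.2)
    else if c.unpair.1 = 5 then .dia (dec c.unpair.2)
    else if c.unpair.1 = 6 then .box (dec c.unpair.2)
    else .bot
termination_by c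
decreasing_by all_goals omega

theorem dec_encode (ψ : Fml) : dec ψ.encode = ψ := by
  induction ψ <;> rw [dec] <;> simp_all [Fml.encode]

theorem spec_of_model {N : KModel.{0}} (hN : N.IsGS4) {n k : ℕ} (g : ℕ → N.W)
    (hg : ∀ x, ∃ i < k, g i = x) {le sq T : ℕ → ℕ → Prop}
    (hle : ∀ x < k, ∀ y < k, (le x y ↔ N.le (g x) (g y)))
    (hsq : ∀ x < k, ∀ y < k, (sq x y ↔ N.sq (g x) (g y)))
    (hT : ∀ c < n + 1, ∀ x < k, (T c x ↔ N.Sat (dec c) (g x)))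
    (hf : ∃ v, ¬ N.Sat (dec n) v) : Spec n k le sq T := by
  have hb := hN.1.1.1
  have hN' := hN
  obtain ⟨⟨⟨⟨h1, h2, h3, h4, h5, h6, h7, h8⟩, h9⟩, h10, h11⟩, h12⟩ := hN
  constructor
  · intro x hx; rw [hle x hx x hx]; exact h1 _
  · intro x hx y hy z hz
    rw [hle x hx y hy, hle y hy z hz, hle x hx z hz]; exact h2 _ _ _
  · intro x hx; rw [hsq x hx x hx]; exact h3 _
  · intro x hx y hy z hz
    rw [hsq x hx y hy, hsq y hy z hz, hsq x hx z hz]; exact h4 _ _ _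
  · intro x hx y hy z hz
    rw [hsq x hx y hy, hle y hy z hz]
    intro a b
    obtain ⟨w, ha, hb⟩ := h9 _ _ _ a b
    obtain ⟨i, hi, rfl⟩ := hg w
    exact ⟨i, hi, (hle x hx i hi).2 ha, (hsq i hi z hz).2 hb⟩
  · intro x hx y hy z hz
    rw [hsq x hx z hz, hle x hx y hy]
    intro a b
    obtain ⟨w, ha, hb⟩ := h10 _ _ _ a b
    obtain ⟨i, hi, rfl⟩ := hg w
    exact ⟨i, hi, (hle z hz i hi).2 ha, (hsq y hy i hi).2 hb⟩
  · intro x hx y hy z hz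
    rw [hle x hx y hy, hle y hy z hz, hle x hx z hz, hle z hz y hy]; exact h12 _ _ _
  · intro c hc x hx
    have e0 := Nat.unpair_right_le c
    have e1 := Nat.unpair_left_le c.unpair.2
    have e2 := Nat.unpair_right_le c.unpair.2
    have l0 : c.unpair.2 < n + 1 := by omega
    have l1 : c.unpair.2.unpair.1 < n + 1 := by omega
    have l2 : c.unpair.2.unpair.2 < n + 1 := by omega
    refine ⟨?_, ?_, ?_, ?_, ?_, ?_, ?_⟩
    · intro _ y hy
      rw [hle x hx y hy, hT c hc x hx, hT c hc y hy]
      exact sat_mono hb _ _ _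
    · intro ht
      rw [hT c hc x hx, dec]
      have : N.fallible = ∅ := h11
      simp [ht, KModel.Sat, this]
    · intro ht
      rw [hT c hc x hx, dec, hT _ l1 x hx, hT _ l2 x hx]
      simp [ht, KModel.Sat]
    · intro ht
      rw [hT c hc x hx, dec, hT _ l1 x hx, hT _ l2 x hx]
      simp [ht, KModel.Sat]
    · intro ht
      rw [hT c hc x hx, dec]
      simp only [ht, KModel.Sat, dite_false, if_true, OfNat.ofNat_ne_zero, Nat.reduceEqDiff,
        if_false]
      constructor
      · intro H y hy hxy hs
        rw [hT _ l2 y hy]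
        exact H _ ((hle x hx y hy).1 hxy) ((hT _ l1 y hy).1 hs)
      · intro H v hv hs
        obtain ⟨y, hy, rfl⟩ := hg v
        exact (hT _ l2 y hy).1 (H y hy ((hle x hx y hy).2 hv) ((hT _ l1 y hy).2 hs))
    · intro ht
      rw [hT c hc x hx, dec]
      simp only [ht, KModel.Sat, dite_false, if_true, OfNat.ofNat_ne_zero, Nat.reduceEqDiff,
        if_false]
      constructor
      · intro H y hy hxy
        obtain ⟨v, hv, hs⟩ := H _ ((hle x hx y hy).1 hxy)
        obtain ⟨z, hz, rfl⟩ := hg v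
        exact ⟨z, hz, (hsq y hy z hz).2 hv, (hT _ l0 z hz).2 hs⟩
      · intro H v hv
        obtain ⟨y, hy, rfl⟩ := hg v
        obtain ⟨z, hz, hyz, hs⟩ := H y hy ((hle x hx y hy).2 hv)
        exact ⟨g z, (hsq y hy z hz).1 hyz, (hT _ l0 z hz).1 hs⟩
    · intro ht
      rw [hT c hc x hx, dec]
      simp only [ht, KModel.Sat, dite_false, if_true, OfNat.ofNat_ne_zero, Nat.reduceEqDiff,
        if_false]
      constructor
      · intro H y hy hxy z hz hyz
        exact (hT _ l0 z hz).2 (H _ _ ((hle x hx y hy).1 hxy) ((hsq y hy z hz).1 hyz))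
      · intro H v u hv hu
        obtain ⟨y, hy, rfl⟩ := hg v
        obtain ⟨z, hz, rfl⟩ := hg u
        exact (hT _ l0 z hz).1 (H y hy ((hle x hx y hy).2 hv) z hz ((hsq y hy z hz).2 hu))
  · obtain ⟨v, hv⟩ := hf
    obtain ⟨i, hi, rfl⟩ := hg v
    exact ⟨i, hi, by rwa [hT n (Nat.lt_succ_self n) i hi]⟩

theorem sub_encode (φ : Fml) : ∀ ψ ∈ φ.subfmls, ψ.encode ≤ φ.encode := by
  induction φ with
  | var n => intro ψ h; simp [Fml.subfmls] at h; subst h; rfl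
  | bot => intro ψ h; simp [Fml.subfmls] at h; subst h; rfl
  | and a b iha ihb | or a b iha ihb | imp a b iha ihb =>
    intro ψ h
    simp only [Fml.subfmls, Finset.mem_insert, Finset.mem_union] at h
    rcases h with h | h | h
    · subst h; rfl
    · exact (iha ψ h).trans (pair_lt_left _ _ _)
    · exact (ihb ψ h).trans (pair_lt_right _ _ _)
  | dia a iha | box a iha =>
    intro ψ h
    simp only [Fml.subfmls, Finset.mem_insert] at h
    rcases h with h | h
    · subst h; rfl
    · exact (iha ψ h).trans (Nat.right_le_pair _ _)

theorem encode_inj : Function.Injective Fml.encode :=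
  Function.LeftInverse.injective dec_encode

theorem sub_card (φ : Fml) : φ.subfmls.card ≤ φ.encode + 1 := by
  have := Finset.card_le_card_of_injOn (t := Finset.range (φ.encode + 1)) Fml.encode
    (fun ψ hψ => by
      have := sub_encode φ ψ hψ
      simp only [Finset.coe_range, Set.mem_Iio]
      omega) encode_inj.injOn
  simpa using this

theorem main_iff (φ : Fml) : mainF.ev [φ.encode] ↔
    ∃ (M : KModel.{u}) (w : M.W), M.IsGS4 ∧ w ∉ M.fallible ∧ ¬ M.Sat φ w := by
  rw [fmp, mainF_ev]
  constructor
  · rintro ⟨k, -, a, -, b, -, t, -, h⟩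
    have h' : ∃ (N : KModel.{0}) (w : N.W), N.IsGS4 ∧ w ∉ N.fallible ∧ ¬ N.Sat φ w := by
      obtain ⟨x, hx, hs⟩ := h.fals
      refine ⟨_, (⟨x, hx⟩ : Fin k), TM_gs4 h, fun h => h.elim, ?_⟩
      rwa [TM_truth h φ (Nat.lt_succ_self _)]
    exact (fmp φ).1 h'
  · rintro ⟨N, v, hN, hfin, hcard, -, hs⟩
    classical
    have e := Finite.equivFin N.W
    obtain ⟨g, hg⟩ : ∃ g : ℕ → N.W, ∀ x, ∃ i < Nat.card N.W, g i = x := by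
      refine ⟨fun i => if h : i < Nat.card N.W then e.symm ⟨i, h⟩ else v, fun x => ?_⟩
      exact ⟨e x, (e x).2, by simp⟩
    generalize Nat.card N.W = k at hcard hg
    refine ⟨k, ?_, ?_⟩
    · have hc := sub_card φ
      refine Nat.lt_succ_of_le (hcard.trans ?_)
      gcongr
      norm_num
    · obtain ⟨a, ha, ha'⟩ := exists_tab (fun x y => N.le (g x) (g y)) k k
      obtain ⟨b, hb, hb'⟩ := exists_tab (fun x y => N.sq (g x) (g y)) k k
      obtain ⟨t, ht, ht'⟩ := exists_tab (fun c x => N.Sat (dec c) (g x)) (φ.encode + 1) k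
      exact ⟨a, ha, b, hb, t, ht, spec_of_model hN g hg ha' hb' ht'
        ⟨v, by rwa [dec_encode]⟩⟩

end GS4Proof

/-- **Decidability of GS4, with an explicit bound.** Validity on the class of all
GS4 frames is decidable: there is a computable function deciding validity through
the encoding of formulas as natural numbers. Moreover, a formula `φ`, whose set
`Σ` of subformulas is finite, is falsifiable on some GS4 frame if and only if it
is falsifiable on a GS4 frame with at most `(|Σ|+1) · 2 ^ (|Σ|(|Σ|+1)+1)` worlds. -/
theorem gs4_decidable_and_bounded_fmp :
    (∃ f : ℕ → Bool, Computable f ∧ ∀ φ : Fml, (f φ.encode = true ↔ GS4Valid.{u} φ)) ∧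
    (∀ φ : Fml,
      (∃ (M : KModel.{u}) (w : M.W), M.IsGS4 ∧ w ∉ M.fallible ∧ ¬ M.Sat φ w) ↔
      (∃ (N : KModel.{0}) (v : N.W), N.IsGS4 ∧ Finite N.W ∧
        Nat.card N.W ≤ (φ.subfmls.card + 1) *
          2 ^ (φ.subfmls.card * (φ.subfmls.card + 1) + 1) ∧
        v ∉ N.fallible ∧ ¬ N.Sat φ v)) := by
  refine ⟨?_, fun φ => GS4Proof.fmp φ⟩
  classical
  have hp : PrimrecPred (fun n : ℕ => ¬ GS4Proof.mainF.ev [n]) :=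
    ((GS4Proof.BF.primrec GS4Proof.mainF).comp
      (Primrec.list_cons.comp Primrec.id (Primrec.const []))).not
  refine ⟨fun n => decide (¬ GS4Proof.mainF.ev [n]), hp.decide.to_comp, fun φ => ?_⟩
  rw [decide_eq_true_iff, GS4Proof.main_iff.{u}]
  constructor
  · intro h M w hM hw
    by_contra hs
    exact h ⟨M, w, hM, hw, hs⟩
  · rintro h ⟨M, w, hM, hw, hs⟩
    exact hs (h M w hM hw)
end

section
/- If an L-formula φ is falsifiable (respectively, satisfiable) on some GS4c frame, then φ is falsifiable (respectively, satisfiable) on some GS4c frame whose set of worlds is finite; that is, the logic GS4c has the finite birelational frame property. Consequently, validity on the class of GS4c frames is decidable. -/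
universe u

/-- Validity on the class of GS4c frames. -/
def GS4cValid (φ : Fml) : Prop :=
  ∀ (M : KModel.{u}) (w : M.W), M.IsGS4c → w ∉ M.fallible → M.Sat φ w


namespace GS4cProof
open KModel

/-- Total decoding of natural numbers as formulas. -/
def dec (n : ℕ) : Fml :=
  if h0 : n.unpair.1 = 0 then .var n.unpair.2
  else
    have hlt : n.unpair.2 < n := Nat.unpair_lt (by
      rcases Nat.eq_zero_or_pos n with h | h
      · subst h; simp at h0
      · exact h) |> fun h => by
        by_contra hc
        have h1 := Nat.pair_unpair n
        have h2 : n.unpair.2 ≤ n := Nat.unpair_right_le n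
        have h3 : n.unpair.2 = n := by omega
        have h4 := Nat.add_le_pair n.unpair.1 n.unpair.2
        omega
    have h1 : n.unpair.2.unpair.1 < n := lt_of_le_of_lt (Nat.unpair_left_le _) hlt
    have h2 : n.unpair.2.unpair.2 < n := lt_of_le_of_lt (Nat.unpair_right_le _) hlt
    if n.unpair.1 = 2 then .and (dec n.unpair.2.unpair.1) (dec n.unpair.2.unpair.2)
    else if n.unpair.1 = 3 then .or (dec n.unpair.2.unpair.1) (dec n.unpair.2.unpair.2)
    else if n.unpair.1 = 4 then .imp (dec n.unpair.2.unpair.1) (dec n.unpair.2.unpair.2)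
    else if n.unpair.1 = 5 then .dia (dec n.unpair.2)
    else if n.unpair.1 = 6 then .box (dec n.unpair.2)
    else .bot
termination_by n

theorem dec_encode (φ : Fml) : dec φ.encode = φ := by
  induction φ <;> rw [dec] <;> simp_all [Fml.encode]

theorem le_pair (a b c d : ℕ) (h1 : a ≤ c) (h2 : b ≤ d) : Nat.pair a b ≤ Nat.pair c d := by
  rcases h1.lt_or_eq with h1 | rfl
  · rcases h2.lt_or_eq with h2 | rfl
    · exact ((Nat.pair_lt_pair_left b h1).trans (Nat.pair_lt_pair_right c h2)).le
    · exact (Nat.pair_lt_pair_left b h1).le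
  · rcases h2.lt_or_eq with h2 | rfl
    · exact (Nat.pair_lt_pair_right a h2).le
    · exact le_rfl

section
universe v

variable {M : KModel.{v}}

theorem sat_mono (h : M.IsBiInt) (φ : Fml) : ∀ x y, M.le x y → M.Sat φ x → M.Sat φ y := by
  obtain ⟨_, htr, _, _, hf, _, hv, _⟩ := h
  induction φ with
  | var p => exact fun x y hxy hx => hv p x y hx hxy
  | bot => exact fun x y hxy hx => hf x y hx hxy
  | and a b iha ihb => exact fun x y hxy hx => ⟨iha x y hxy hx.1, ihb x y hxy hx.2⟩
  | or a b iha ihb => exact fun x y hxy hx => hx.imp (iha x y hxy) (ihb x y hxy)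
  | imp a b _ _ => exact fun x y hxy hx z hz => hx z (htr _ _ _ hxy hz)
  | dia a _ => exact fun x y hxy hx z hz => hx z (htr _ _ _ hxy hz)
  | box a _ => exact fun x y hxy hx z u hz => hx z u (htr _ _ _ hxy hz)

/-- The convex closure of the modal relation. -/
def R (M : KModel.{v}) (x y : M.W) : Prop :=
  (∃ x1, M.le x x1 ∧ M.sq x1 y) ∧ ∃ y1, M.le y y1 ∧ M.sq x y1

theorem R_refl (h : M.IsGS4c) (x : M.W) : R M x x := by
  obtain ⟨⟨⟨⟨⟨lr, lt, sr, st, -⟩, bu⟩, fu, inf⟩, lin⟩, fd⟩ := h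
  exact ⟨⟨x, lr x, sr x⟩, x, lr x, sr x⟩

theorem R_trans (h : M.IsGS4c) (x y z : M.W) (h1 : R M x y) (h2 : R M y z) : R M x z := by
  obtain ⟨⟨⟨⟨⟨lr, lt, sr, st, -⟩, bu⟩, fu, inf⟩, lin⟩, fd⟩ := h
  obtain ⟨⟨x1, a1, a2⟩, y1, a3, a4⟩ := h1
  obtain ⟨⟨y2, b1, b2⟩, z1, b3, b4⟩ := h2
  obtain ⟨x2, c1, c2⟩ := bu _ _ _ a2 b1
  obtain ⟨z2, d1, d2⟩ := fu _ _ _ a3 b4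
  exact ⟨⟨x2, lt _ _ _ a1 c1, st _ _ _ c2 b2⟩, z2, lt _ _ _ b3 d1, st _ _ _ a4 d2⟩

theorem R_of_sq (h : M.IsGS4c) (x y : M.W) (h1 : M.sq x y) : R M x y := by
  obtain ⟨⟨⟨⟨⟨lr, lt, sr, st, -⟩, bu⟩, fu, inf⟩, lin⟩, fd⟩ := h
  exact ⟨⟨x, lr x, h1⟩, y, lr y, h1⟩

theorem R_fu (h : M.IsGS4c) (w w' v : M.W) (h1 : M.le w w') (h2 : R M w v) :
    ∃ v', M.le v v' ∧ R M w' v' := by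
  have hh := h
  obtain ⟨⟨⟨⟨⟨lr, lt, sr, st, -⟩, bu⟩, fu, inf⟩, lin⟩, fd⟩ := h
  obtain ⟨⟨x1, a1, a2⟩, y1, a3, a4⟩ := h2
  obtain ⟨z, c1, c2⟩ := fu _ _ _ h1 a4
  exact ⟨z, lt _ _ _ a3 c1, R_of_sq hh _ _ c2⟩

theorem R_bu (h : M.IsGS4c) (w v v' : M.W) (h1 : R M w v) (h2 : M.le v v') :
    ∃ w', M.le w w' ∧ R M w' v' := by
  have hh := h
  obtain ⟨⟨⟨⟨⟨lr, lt, sr, st, -⟩, bu⟩, fu, inf⟩, lin⟩, fd⟩ := h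
  obtain ⟨⟨x1, a1, a2⟩, y1, a3, a4⟩ := h1
  obtain ⟨z, c1, c2⟩ := bu _ _ _ a2 h2
  exact ⟨z, lt _ _ _ a1 c1, R_of_sq hh _ _ c2⟩

theorem R_fd (h : M.IsGS4c) (w v v' : M.W) (h1 : M.le w v) (h2 : R M v v') :
    ∃ w', R M w w' ∧ M.le w' v' := by
  have hh := h
  obtain ⟨⟨⟨⟨⟨lr, lt, sr, st, -⟩, bu⟩, fu, inf⟩, lin⟩, fd⟩ := h
  obtain ⟨⟨x1, a1, a2⟩, y1, a3, a4⟩ := h2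
  obtain ⟨z, c1, c2⟩ := fd _ _ _ (lt _ _ _ h1 a1) a2
  exact ⟨z, R_of_sq hh _ _ c1, c2⟩

theorem R_convex (h : M.IsGS4c) (x x1 y y1 : M.W) (h1 : M.le x x1) (h2 : R M x1 y)
    (h3 : R M x y1) (h4 : M.le y y1) : R M x y := by
  obtain ⟨⟨⟨⟨⟨lr, lt, sr, st, -⟩, bu⟩, fu, inf⟩, lin⟩, fd⟩ := h
  obtain ⟨⟨a, a1, a2⟩, -⟩ := h2
  obtain ⟨-, b, b1, b2⟩ := h3
  exact ⟨⟨a, lt _ _ _ h1 a1, a2⟩, b, lt _ _ _ h4 b1, b2⟩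

/-- Forth-down inside columns. -/
theorem R_fd_col (h : M.IsGS4c) (v x x' u y' : M.W) (h1 : M.le v x) (h2 : M.le x x')
    (h3 : R M v u) (h4 : R M x' y') (h5 : M.le u y') :
    ∃ y, M.le u y ∧ M.le y y' ∧ R M x y := by
  obtain ⟨y2, a1, a2⟩ := R_fu h _ _ _ h1 h3
  have lin := h.1.2
  have lr := h.1.1.1.1.1
  rcases lin _ _ _ a1 h5 with hl | hl
  · exact ⟨y2, a1, hl, a2⟩
  · exact ⟨y', h5, lr _, R_convex h _ _ _ _ h2 h4 a2 hl⟩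

theorem sat_dia (h : M.IsGS4c) (φ : Fml) (x : M.W) :
    M.Sat (.dia φ) x ↔ ∃ y, R M x y ∧ M.Sat φ y := by
  have hm := sat_mono h.1.1.1.1 φ
  constructor
  · intro hx
    obtain ⟨y, h1, h2⟩ := hx x (h.1.1.1.1.1 x)
    exact ⟨y, R_of_sq h _ _ h1, h2⟩
  · rintro ⟨y, ⟨-, y1, h1, h2⟩, h3⟩ u hu
    obtain ⟨z, c1, c2⟩ := h.1.1.2.1 _ _ _ hu h2
    exact ⟨z, c2, hm _ _ c1 (hm _ _ h1 h3)⟩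

theorem sat_box (h : M.IsGS4c) (φ : Fml) (x : M.W) :
    M.Sat (.box φ) x ↔ ∀ y, R M x y → M.Sat φ y := by
  have hm := sat_mono h.1.1.1.1 φ
  constructor
  · rintro hx y ⟨⟨x1, h1, h2⟩, -⟩
    exact hx _ _ h1 h2
  · intro hx u v hu hv
    obtain ⟨z, c1, c2⟩ := h.2 _ _ _ hu hv
    exact hm _ _ c2 (hx z (R_of_sq h _ _ c1))

/-- The type of a world. -/
def ty (M : KModel.{v}) (n : ℕ) (x : M.W) : Set (Fin (n + 1)) := {a | M.Sat (dec a) x}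

/-- The set of types above a world. -/
def col (M : KModel.{v}) (n : ℕ) (x : M.W) : Set (Set (Fin (n + 1))) :=
  {t | ∃ y, M.le x y ∧ ty M n y = t}

theorem ty_sub {n : ℕ} {x y : M.W} (h : ty M n x ⊆ ty M n y) {ψ : Fml} (hψ : ψ.encode ≤ n)
    (hx : M.Sat ψ x) : M.Sat ψ y := by
  have := @h ⟨ψ.encode, by omega⟩ (by simpa [ty, dec_encode] using hx)
  simpa [ty, dec_encode] using this

theorem ty_mono (h : M.IsGS4c) {n : ℕ} {x y : M.W} (hxy : M.le x y) : ty M n x ⊆ ty M n y :=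
  fun _ ha => sat_mono h.1.1.1.1 _ _ _ hxy ha

def Rep (M : KModel.{v}) (n : ℕ) (p : Set (Set (Fin (n + 1))) × Set (Fin (n + 1)))
    (v x : M.W) : Prop := M.le v x ∧ p = (col M n v, ty M n x)

def FW (M : KModel.{v}) (n : ℕ) : Type :=
  {p : Set (Set (Fin (n + 1))) × Set (Fin (n + 1)) // ∃ v x, Rep M n p v x}

def R0 (M : KModel.{v}) (n : ℕ) (p q : FW M n) : Prop :=
  ∃ v x u y, Rep M n p.1 v x ∧ Rep M n q.1 u y ∧ R M v u ∧ R M x y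

/-- The finite model. -/
def fin (M : KModel.{v}) (n : ℕ) : KModel.{0} where
  W := FW M n
  fallible := ∅
  le p q := p.1.1 = q.1.1 ∧ p.1.2 ⊆ q.1.2
  sq := Relation.ReflTransGen (R0 M n)
  val i := {w | ∃ v x, Rep M n w.1 v x ∧ (Fml.var i).encode ≤ n ∧ M.Sat (.var i) x}

theorem lift_up (h : M.IsGS4c) {n : ℕ} {p q : FW M n} {v x : M.W} (hp : Rep M n p.1 v x)
    (hpq : (fin M n).le p q) : ∃ x', M.le x x' ∧ Rep M n q.1 v x' := by
  obtain ⟨⟨C, t⟩, v', z, hz, hq⟩ := q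
  obtain ⟨⟨C', t'⟩, _⟩ := p
  obtain ⟨hvx, hp⟩ := hp
  have lin := h.1.2
  have lr := h.1.1.1.1.1
  have lt := h.1.1.1.1.2.1
  simp only [Prod.mk.injEq] at hq hp
  obtain ⟨rfl, rfl⟩ := hp
  obtain ⟨rfl, rfl⟩ := hq
  obtain ⟨h1, h2⟩ := hpq
  simp only at h1 h2
  have : ty M n z ∈ col M n v := by rw [h1]; exact ⟨z, hz, rfl⟩
  obtain ⟨x2, h3, h4⟩ := this
  rcases lin _ _ _ hvx h3 with hl | hl
  · exact ⟨x2, hl, h3, Prod.ext h1.symm h4.symm⟩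
  · exact ⟨x, lr x, hvx, Prod.ext h1.symm (Set.Subset.antisymm (h4.symm.subset.trans (ty_mono h hl)) h2)⟩

theorem lift_down (h : M.IsGS4c) {n : ℕ} {p q : FW M n} {v x : M.W} (hp : Rep M n p.1 v x)
    (hpq : (fin M n).le q p) : ∃ x', M.le x' x ∧ Rep M n q.1 v x' := by
  obtain ⟨⟨C, t⟩, v', z, hz, hq⟩ := q
  obtain ⟨⟨C', t'⟩, _⟩ := p
  obtain ⟨hvx, hp⟩ := hp
  have lin := h.1.2
  have lr := h.1.1.1.1.1
  have lt := h.1.1.1.1.2.1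
  simp only [Prod.mk.injEq] at hq hp
  obtain ⟨rfl, rfl⟩ := hp
  obtain ⟨rfl, rfl⟩ := hq
  obtain ⟨h1, h2⟩ := hpq
  simp only at h1 h2
  have : ty M n z ∈ col M n v := by rw [← h1]; exact ⟨z, hz, rfl⟩
  obtain ⟨x2, h3, h4⟩ := this
  rcases lin _ _ _ hvx h3 with hl | hl
  · exact ⟨x, lr x, hvx, Prod.ext h1 (Set.Subset.antisymm h2 ((ty_mono h hl).trans h4.subset))⟩
  · exact ⟨x2, hl, h3, Prod.ext h1 h4.symm⟩

theorem le_of_rep (h : M.IsGS4c) {n : ℕ} {p q : FW M n} {v x x' : M.W} (hp : Rep M n p.1 v x)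
    (hq : Rep M n q.1 v x') (hx : M.le x x') : (fin M n).le p q := by
  refine ⟨?_, ?_⟩
  · rw [hp.2, hq.2]
  · rw [hp.2, hq.2]; exact ty_mono h hx

theorem fin_gs4c (h : M.IsGS4c) (n : ℕ) : (fin M n).IsGS4c := by
  have lin := h.1.2
  have lr := h.1.1.1.1.1
  have lt := h.1.1.1.1.2.1
  refine ⟨⟨⟨⟨⟨?_, ?_, ?_, ?_, ?_, ?_, ?_, ?_⟩, ?_⟩, ?_, ?_⟩, ?_⟩, ?_⟩
  · exact fun w => ⟨rfl, subset_rfl⟩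
  · exact fun u v w h1 h2 => ⟨h1.1.trans h2.1, h1.2.trans h2.2⟩
  · exact fun w => Relation.ReflTransGen.refl
  · exact fun u v w h1 h2 => Relation.ReflTransGen.trans h1 h2
  · exact fun w v hw _ => hw.elim
  · exact fun w v hw _ => hw.elim
  · rintro i w w' ⟨v, x, h1, h2, h3⟩ hle
    obtain ⟨x', h4, h5⟩ := lift_up h h1 hle
    exact ⟨v, x', h5, h2, sat_mono h.1.1.1.1 _ _ _ h4 h3⟩
  · exact fun p w hw => hw.elim
  · -- back-up
    intro w z z' hwz hz
    induction hwz generalizing z' with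
    | refl => exact ⟨z', hz, Relation.ReflTransGen.refl⟩
    | tail _ hs ih =>
      obtain ⟨v, x, u, y, h1, h2, h3, h4⟩ := hs
      obtain ⟨y', h5, h6⟩ := lift_up h h2 hz
      obtain ⟨x', h7, h8⟩ := R_bu h _ _ _ h4 h5
      obtain ⟨w', h9, h10⟩ := ih ⟨_, v, x', lt _ _ _ h1.1 h7, rfl⟩
        (le_of_rep h h1 ⟨lt _ _ _ h1.1 h7, rfl⟩ h7)
      exact ⟨w', h9, h10.tail ⟨v, x', u, y', ⟨lt _ _ _ h1.1 h7, rfl⟩, h6, h3, h8⟩⟩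
  · -- forth-up
    intro w w' z hw hwz
    induction hwz with
    | refl => exact ⟨w', hw, Relation.ReflTransGen.refl⟩
    | tail _ hs ih =>
      obtain ⟨b', h9, h10⟩ := ih
      obtain ⟨v, x, u, y, h1, h2, h3, h4⟩ := hs
      obtain ⟨x', h5, h6⟩ := lift_up h h1 h9
      obtain ⟨y', h7, h8⟩ := R_fu h _ _ _ h5 h4
      have hu := lt _ _ _ h2.1 h7
      exact ⟨⟨_, u, y', hu, rfl⟩, le_of_rep h h2 ⟨hu, rfl⟩ h7,
        h10.tail ⟨v, x', u, y', h6, ⟨hu, rfl⟩, h3, h8⟩⟩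
  · rfl
  · -- linear
    rintro w w1 w2 h1 h2
    obtain ⟨v, x, hx⟩ := w.2
    obtain ⟨x1, a1, a2⟩ := lift_up h hx h1
    obtain ⟨x2, b1, b2⟩ := lift_up h hx h2
    rcases lin _ _ _ a1 b1 with hl | hl
    · exact Or.inl (le_of_rep h a2 b2 hl)
    · exact Or.inr (le_of_rep h b2 a2 hl)
  · -- forth-down
    intro w w' z hw hwz
    induction hwz with
    | refl => exact ⟨w, Relation.ReflTransGen.refl, hw⟩
    | tail _ hs ih =>
      obtain ⟨b', h10, h9⟩ := ih
      obtain ⟨v, x, u, y, h1, h2, h3, h4⟩ := hs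
      obtain ⟨x', h5, h6⟩ := lift_down h h1 h9
      obtain ⟨y', h7, h8, h11⟩ := R_fd_col h _ _ _ _ _ h6.1 h5 h3 h4 h2.1
      exact ⟨⟨_, u, y', h7, rfl⟩, h10.tail ⟨v, x', u, y', h6, ⟨h7, rfl⟩, h3, h11⟩,
        le_of_rep h ⟨h7, rfl⟩ h2 h8⟩

theorem rep_sat {n : ℕ} {p : FW M n} {v x v' x' : M.W} (h1 : Rep M n p.1 v x)
    (h2 : Rep M n p.1 v' x') {ψ : Fml} (hψ : ψ.encode ≤ n) (hx : M.Sat ψ x) : M.Sat ψ x' := by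
  have := h1.2.symm.trans h2.2
  exact ty_sub (Prod.mk.inj this).2.subset hψ hx

theorem path_dia (h : M.IsGS4c) {n : ℕ} {φ : Fml} (hφ : φ.dia.encode ≤ n) {p q : FW M n}
    (hpq : (fin M n).sq p q) :
    (∀ u y, Rep M n q.1 u y → M.Sat φ.dia y) → ∀ v x, Rep M n p.1 v x → M.Sat φ.dia x := by
  intro hq
  induction hpq with
  | refl => exact hq
  | tail _ hs ih =>
    apply ih
    obtain ⟨v, x, u, y, h1, h2, h3, h4⟩ := hs
    intro v' x' h5
    refine rep_sat h1 h5 hφ ?_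
    have := hq _ _ h2
    rw [sat_dia h] at this ⊢
    obtain ⟨z, h6, h7⟩ := this
    exact ⟨z, R_trans h _ _ _ h4 h6, h7⟩

theorem path_box (h : M.IsGS4c) {n : ℕ} {φ : Fml} (hφ : φ.box.encode ≤ n) {p q : FW M n}
    (hpq : (fin M n).sq p q) :
    (∀ u y, Rep M n p.1 u y → M.Sat φ.box y) → ∀ v x, Rep M n q.1 v x → M.Sat φ.box x := by
  intro hq
  induction hpq with
  | refl => exact hq
  | tail _ hs ih =>
    obtain ⟨v, x, u, y, h1, h2, h3, h4⟩ := hs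
    intro v' x' h5
    refine rep_sat h2 h5 hφ ?_
    have := ih _ _ h1
    rw [sat_box h] at this ⊢
    exact fun z hz => this z (R_trans h _ _ _ h4 hz)

theorem truth (h : M.IsGS4c) (n : ℕ) (ψ : Fml) : ψ.encode ≤ n → ∀ (w : FW M n) (v x : M.W),
    Rep M n w.1 v x → ((fin M n).Sat ψ w ↔ M.Sat ψ x) := by
  have lr := h.1.1.1.1.1
  have lt := h.1.1.1.1.2.1
  have binl : ∀ k a b, Nat.pair k (Nat.pair a b) ≤ n → a ≤ n ∧ b ≤ n := fun k a b hk =>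
    ⟨(Nat.left_le_pair a b).trans ((Nat.right_le_pair k _).trans hk),
      (Nat.right_le_pair a b).trans ((Nat.right_le_pair k _).trans hk)⟩
  induction ψ with
  | var i =>
    intro hn w v x hw
    constructor
    · rintro ⟨v', x', h1, h2, h3⟩
      exact rep_sat h1 hw hn h3
    · exact fun hx => ⟨v, x, hw, hn, hx⟩
  | bot =>
    intro hn w v x hw
    have := h.1.1.2.2
    simp only [Infallible] at this
    simp only [Sat, this]
    exact ⟨fun hw => hw.elim, fun hw => hw.elim⟩
  | and a b iha ihb =>
    intro hn w v x hw
    obtain ⟨ha, hb⟩ := binl _ _ _ hn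
    simp only [Sat]
    rw [iha ha w v x hw, ihb hb w v x hw]
  | or a b iha ihb =>
    intro hn w v x hw
    obtain ⟨ha, hb⟩ := binl _ _ _ hn
    simp only [Sat]
    rw [iha ha w v x hw, ihb hb w v x hw]
  | imp a b iha ihb =>
    intro hn w v x hw
    obtain ⟨ha, hb⟩ := binl _ _ _ hn
    constructor
    · intro hs x' hx' hax
      have hr : Rep M n (col M n v, ty M n x') v x' := ⟨lt _ _ _ hw.1 hx', rfl⟩
      have := hs ⟨_, v, x', hr⟩ (le_of_rep h hw hr hx') ((iha ha _ _ _ hr).2 hax)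
      exact (ihb hb _ _ _ hr).1 this
    · intro hs w' hw' haw
      obtain ⟨x', h1, h2⟩ := lift_up h hw hw'
      exact (ihb hb _ _ _ h2).2 (hs x' h1 ((iha ha _ _ _ h2).1 haw))
  | dia a iha =>
    intro hn w v x hw
    have ha : a.encode ≤ n := (Nat.right_le_pair 5 _).trans hn
    constructor
    · intro hs
      obtain ⟨z, h1, h2⟩ := hs w ⟨rfl, subset_rfl⟩
      refine path_dia h hn h1 ?_ v x hw
      intro u y hy
      rw [sat_dia h]
      exact ⟨y, R_refl h y, (iha ha _ _ _ hy).1 h2⟩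
    · intro hs w' hw'
      obtain ⟨x', h1, h2⟩ := lift_up h hw hw'
      have h3 := sat_mono h.1.1.1.1 _ _ _ h1 hs
      rw [sat_dia h] at h3
      obtain ⟨y, h4, h5⟩ := h3
      obtain ⟨u, h6, h7⟩ := R_fd h _ _ _ h2.1 h4
      have hr : Rep M n (col M n u, ty M n y) u y := ⟨h7, rfl⟩
      exact ⟨⟨_, u, y, hr⟩, Relation.ReflTransGen.single ⟨v, x', u, y, h2, hr, h6, h4⟩,
        (iha ha _ _ _ hr).2 h5⟩
  | box a iha =>
    intro hn w v x hw
    have ha : a.encode ≤ n := (Nat.right_le_pair 6 _).trans hn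
    constructor
    · intro hs
      rw [sat_box h]
      intro y hy
      obtain ⟨u, h6, h7⟩ := R_fd h _ _ _ hw.1 hy
      have hr : Rep M n (col M n u, ty M n y) u y := ⟨h7, rfl⟩
      have := hs w ⟨_, u, y, hr⟩ ⟨rfl, subset_rfl⟩
        (Relation.ReflTransGen.single ⟨v, x, u, y, hw, hr, h6, hy⟩)
      exact (iha ha _ _ _ hr).1 this
    · intro hs w' z hw' hz
      obtain ⟨x', h1, h2⟩ := lift_up h hw hw'
      have h3 := sat_mono h.1.1.1.1 _ _ _ h1 hs
      obtain ⟨u, y, hy⟩ := z.2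
      refine (iha ha _ _ _ hy).2 ?_
      have := path_box h hn hz (fun u y hy => rep_sat h2 hy hn h3) u y hy
      rw [sat_box h] at this
      exact this y (R_refl h y)

end

instance fin_finite (M : KModel.{u}) (n : ℕ) : Finite (fin M n).W := by
  unfold fin FW; infer_instance

theorem fin_card (M : KModel.{u}) (n : ℕ) :
    Nat.card (fin M n).W ≤ 2 ^ (2 ^ (n + 1)) * 2 ^ (n + 1) := by
  have h1 : Nat.card (fin M n).W ≤
      Nat.card (Set (Set (Fin (n + 1))) × Set (Fin (n + 1))) :=
    Nat.card_le_card_of_injective (fun w : FW M n => w.1) Subtype.val_injective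
  refine h1.trans (le_of_eq ?_)
  simp [Nat.card_eq_fintype_card]

/-- Finite model property with code bound. -/
theorem fmp (M : KModel.{u}) (w : M.W) (h : M.IsGS4c) (φ : Fml) :
    ∃ v : (fin M φ.encode).W, ((fin M φ.encode).Sat φ v ↔ M.Sat φ w) :=
  ⟨⟨_, w, w, h.1.1.1.1.1 w, rfl⟩, truth h _ φ le_rfl _ w w ⟨h.1.1.1.1.1 w, rfl⟩⟩


/-! ### Bounded arithmetic predicates -/

inductive Tm : Type where
  | v : ℕ → Tm
  | c : ℕ → Tm
  | p : Tm → Tm → Tm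
  | l : Tm → Tm
  | r : Tm → Tm

def Tm.ev : Tm → List ℕ → ℕ
  | .v i, e => e.getD i 0
  | .c k, _ => k
  | .p s t, e => Nat.pair (s.ev e) (t.ev e)
  | .l s, e => (s.ev e).unpair.1
  | .r s, e => (s.ev e).unpair.2

inductive BF : Type where
  | eq : Tm → Tm → BF
  | bit : Tm → Tm → BF
  | not : BF → BF
  | and : BF → BF → BF
  | all : Tm → BF → BF

def BF.ev : BF → List ℕ → Prop
  | .eq s t, e => s.ev e = t.ev e
  | .bit s t, e => (s.ev e) / 2 ^ (t.ev e) % 2 = 1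
  | .not f, e => ¬ f.ev e
  | .and f g, e => f.ev e ∧ g.ev e
  | .all t f, e => ∀ x < t.ev e, f.ev (x :: e)

theorem primrec_pow2 : Primrec (fun n : ℕ => 2 ^ n) := by
  have h : Primrec (fun n : ℕ => Nat.rec (motive := fun _ => ℕ) 1 (fun _ y => y * 2) n) :=
    Primrec.nat_rec₁ 1 ((Primrec.nat_mul.comp Primrec.snd (Primrec.const 2)).to₂)
  refine h.of_eq fun n => ?_
  induction n with
  | zero => rfl
  | succ k ih => simp only [pow_succ, ih]

theorem exists_lt' {β : Type} [Primcodable β] {Q : ℕ → β → Prop} (hf : PrimrecRel Q) :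
    PrimrecRel fun n y => ∃ x < n, Q x y :=
  (hf.exists_mem_list.comp (Primrec.list_range.comp Primrec.fst) Primrec.snd).of_eq (by simp)

theorem forall_lt' {β : Type} [Primcodable β] {Q : ℕ → β → Prop} (hf : PrimrecRel Q) :
    PrimrecRel fun n y => ∀ x < n, Q x y :=
  (hf.forall_mem_list.comp (Primrec.list_range.comp Primrec.fst) Primrec.snd).of_eq (by simp)

theorem Tm.primrec (t : Tm) : Primrec t.ev := by
  induction t with
  | v i => exact (Primrec.list_getD 0).comp Primrec.id (Primrec.const i)
  | c k => exact Primrec.const k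
  | p s t h1 h2 => exact Primrec₂.natPair.comp h1 h2
  | l s h => exact Primrec.fst.comp (Primrec.unpair.comp h)
  | r s h => exact Primrec.snd.comp (Primrec.unpair.comp h)

theorem BF.primrec (f : BF) : PrimrecPred f.ev := by
  induction f with
  | eq s t =>
    have : PrimrecPred (fun e => s.ev e = t.ev e) :=
      PrimrecRel.comp (R := fun a b : ℕ => a = b) Primrec.eq s.primrec t.primrec
    exact this
  | bit s t =>
    have h1 : Primrec (fun e => s.ev e / 2 ^ (t.ev e) % 2) :=
      Primrec.nat_mod.comp (Primrec.nat_div.comp s.primrec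
        (primrec_pow2.comp t.primrec)) (Primrec.const 2)
    have : PrimrecPred (fun e => s.ev e / 2 ^ (t.ev e) % 2 = 1) :=
      PrimrecRel.comp (R := fun a b : ℕ => a = b) Primrec.eq h1 (Primrec.const 1)
    exact this
  | not f h => exact h.not
  | and f g h1 h2 => exact h1.and h2
  | all t f h =>
    have h1 : PrimrecRel (fun (x : ℕ) (e : List ℕ) => f.ev (x :: e)) :=
      PrimrecPred.comp h (Primrec.list_cons.comp Primrec.fst Primrec.snd)
    have h2 := forall_lt' h1
    have h3 : PrimrecPred (fun e => ∀ x < t.ev e, f.ev (x :: e)) :=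
      PrimrecRel.comp (f := t.ev) (g := fun e => e) h2 t.primrec Primrec.id
    exact h3

def BF.or (f g : BF) : BF := .not (.and (.not f) (.not g))
def BF.imp (f g : BF) : BF := .not (.and f (.not g))
def BF.iff (f g : BF) : BF := .and (f.imp g) (g.imp f)
def BF.ex (t : Tm) (f : BF) : BF := .not (.all t (.not f))

@[simp] theorem BF.ev_or (f g : BF) (e) : (f.or g).ev e ↔ (f.ev e ∨ g.ev e) := by
  simp only [BF.or, BF.ev]; tauto
@[simp] theorem BF.ev_imp (f g : BF) (e) : (f.imp g).ev e ↔ (f.ev e → g.ev e) := by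
  simp only [BF.imp, BF.ev]; tauto
@[simp] theorem BF.ev_iff (f g : BF) (e) : (f.iff g).ev e ↔ (f.ev e ↔ g.ev e) := by
  simp only [BF.iff, BF.ev, BF.ev_imp]; tauto
@[simp] theorem BF.ev_ex (t : Tm) (f : BF) (e) :
    (BF.ex t f).ev e ↔ ∃ x < t.ev e, f.ev (x :: e) := by
  simp only [BF.ex, BF.ev]; push Not; rfl

/-- Bit number `pair k (pair a b)` of `m`. -/
def B (m k a b : ℕ) : Prop := m / 2 ^ (Nat.pair k (Nat.pair a b)) % 2 = 1

/-- `m` codes a birelational GS4c structure on `{0,…,N-1}`. -/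
def IsFrame (N m : ℕ) : Prop :=
  (∀ w < N, B m 0 w w ∧ B m 1 w w) ∧
  (∀ u < N, ∀ v < N, ∀ w < N, (B m 0 u v → B m 0 v w → B m 0 u w) ∧
    (B m 1 u v → B m 1 v w → B m 1 u w) ∧
    (B m 0 u v → B m 0 u w → (B m 0 v w ∨ B m 0 w v)) ∧
    (B m 0 u v → B m 1 u w → ∃ z < N, B m 0 w z ∧ B m 1 v z) ∧
    (B m 1 u v → B m 0 v w → ∃ z < N, B m 0 u z ∧ B m 1 z w) ∧
    (B m 0 u v → B m 1 v w → ∃ z < N, B m 1 u z ∧ B m 0 z w))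

/-- `m` codes a correct truth table for the code `a`. -/
def IsTable (N m a : ℕ) : Prop :=
  (a.unpair.1 = 0 → ∀ w < N, ∀ v < N, B m 0 w v → B m 2 a w → B m 2 a v) ∧
  (a.unpair.1 = 1 → ∀ w < N, ¬ B m 2 a w) ∧
  (a.unpair.1 = 2 → ∀ w < N,
    (B m 2 a w ↔ (B m 2 a.unpair.2.unpair.1 w ∧ B m 2 a.unpair.2.unpair.2 w))) ∧
  (a.unpair.1 = 3 → ∀ w < N,
    (B m 2 a w ↔ (B m 2 a.unpair.2.unpair.1 w ∨ B m 2 a.unpair.2.unpair.2 w))) ∧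
  (a.unpair.1 = 4 → ∀ w < N, (B m 2 a w ↔ ∀ v < N, B m 0 w v →
    B m 2 a.unpair.2.unpair.1 v → B m 2 a.unpair.2.unpair.2 v)) ∧
  (a.unpair.1 = 5 → ∀ w < N, (B m 2 a w ↔ ∀ v < N, B m 0 w v →
    ∃ z < N, B m 1 v z ∧ B m 2 a.unpair.2 z)) ∧
  (a.unpair.1 = 6 → ∀ w < N, (B m 2 a w ↔ ∀ v < N, ∀ z < N, B m 0 w v →
    B m 1 v z → B m 2 a.unpair.2 z))

def bb (m : ℕ) (k : ℕ) (a b : Tm) : BF := .bit (.v m) (.p (.c k) (.p a b))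

theorem isFrame_primrec :
    ∃ f : BF, ∀ m N n1 n, f.ev [m, N, n1, n] ↔ IsFrame N m := by
  refine ⟨.and (.all (.v 1) (.and (bb 1 0 (.v 0) (.v 0)) (bb 1 1 (.v 0) (.v 0))))
    (.all (.v 1) (.all (.v 2) (.all (.v 3)
      (.and (.imp (bb 3 0 (.v 2) (.v 1)) (.imp (bb 3 0 (.v 1) (.v 0)) (bb 3 0 (.v 2) (.v 0))))
      (.and (.imp (bb 3 1 (.v 2) (.v 1)) (.imp (bb 3 1 (.v 1) (.v 0)) (bb 3 1 (.v 2) (.v 0))))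
      (.and (.imp (bb 3 0 (.v 2) (.v 1)) (.imp (bb 3 0 (.v 2) (.v 0))
        (.or (bb 3 0 (.v 1) (.v 0)) (bb 3 0 (.v 0) (.v 1)))))
      (.and (.imp (bb 3 0 (.v 2) (.v 1)) (.imp (bb 3 1 (.v 2) (.v 0))
        (.ex (.v 4) (.and (bb 4 0 (.v 1) (.v 0)) (bb 4 1 (.v 2) (.v 0))))))
      (.and (.imp (bb 3 1 (.v 2) (.v 1)) (.imp (bb 3 0 (.v 1) (.v 0))
        (.ex (.v 4) (.and (bb 4 0 (.v 3) (.v 0)) (bb 4 1 (.v 0) (.v 1))))))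
      (.imp (bb 3 0 (.v 2) (.v 1)) (.imp (bb 3 1 (.v 1) (.v 0))
        (.ex (.v 4) (.and (bb 4 1 (.v 3) (.v 0)) (bb 4 0 (.v 0) (.v 1)))))))))))))), ?_⟩
  intro m N n1 n
  simp [BF.ev, Tm.ev, bb, IsFrame, B]

theorem isTable_primrec :
    ∃ f : BF, ∀ a m N n1 n, f.ev [a, m, N, n1, n] ↔ IsTable N m a := by
  refine ⟨.and (.imp (.eq (.l (.v 0)) (.c 0)) (.all (.v 2) (.all (.v 3) (.imp
      (bb 3 0 (.v 1) (.v 0)) (.imp (bb 3 2 (.v 2) (.v 1)) (bb 3 2 (.v 2) (.v 0)))))))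
    (.and (.imp (.eq (.l (.v 0)) (.c 1)) (.all (.v 2) (.not (bb 2 2 (.v 1) (.v 0)))))
    (.and (.imp (.eq (.l (.v 0)) (.c 2)) (.all (.v 2) (.iff (bb 2 2 (.v 1) (.v 0))
      (.and (bb 2 2 (.l (.r (.v 1))) (.v 0)) (bb 2 2 (.r (.r (.v 1))) (.v 0))))))
    (.and (.imp (.eq (.l (.v 0)) (.c 3)) (.all (.v 2) (.iff (bb 2 2 (.v 1) (.v 0))
      (.or (bb 2 2 (.l (.r (.v 1))) (.v 0)) (bb 2 2 (.r (.r (.v 1))) (.v 0))))))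
    (.and (.imp (.eq (.l (.v 0)) (.c 4)) (.all (.v 2) (.iff (bb 2 2 (.v 1) (.v 0))
      (.all (.v 3) (.imp (bb 3 0 (.v 1) (.v 0)) (.imp
        (bb 3 2 (.l (.r (.v 2))) (.v 0)) (bb 3 2 (.r (.r (.v 2))) (.v 0))))))))
    (.and (.imp (.eq (.l (.v 0)) (.c 5)) (.all (.v 2) (.iff (bb 2 2 (.v 1) (.v 0))
      (.all (.v 3) (.imp (bb 3 0 (.v 1) (.v 0)) (.ex (.v 4) (.and
        (bb 4 1 (.v 1) (.v 0)) (bb 4 2 (.r (.v 3)) (.v 0)))))))))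
    (.imp (.eq (.l (.v 0)) (.c 6)) (.all (.v 2) (.iff (bb 2 2 (.v 1) (.v 0))
      (.all (.v 3) (.all (.v 4) (.imp (bb 4 0 (.v 2) (.v 1)) (.imp
        (bb 4 1 (.v 1) (.v 0)) (bb 4 2 (.r (.v 3)) (.v 0)))))))))))))), ?_⟩
  intro a m N n1 n
  simp [BF.ev, Tm.ev, bb, IsTable, B]

/-- A refutation certificate. -/
def Cert (n N m : ℕ) : Prop :=
  IsFrame N m ∧ (∀ a < n + 1, IsTable N m a) ∧ ∃ w < N, ¬ B m 2 n w

/-- Bounds. -/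
def bN (n : ℕ) : ℕ := 2 ^ (2 ^ (n + 1)) * 2 ^ (n + 1) + 1
def bK (n : ℕ) : ℕ := Nat.pair 2 (Nat.pair (bN n + n) (bN n + n)) + 1
def bM (n : ℕ) : ℕ := 2 ^ bK n

def Refutable (n : ℕ) : Prop := ∃ N < bN n, ∃ m < bM n, Cert n N m

theorem bN_primrec : Primrec bN := by
  unfold bN
  exact Primrec.succ.comp (Primrec.nat_mul.comp
    (primrec_pow2.comp (primrec_pow2.comp Primrec.succ)) (primrec_pow2.comp Primrec.succ))

theorem bM_primrec : Primrec bM := by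
  unfold bM bK
  have h : Primrec fun n => bN n + n := Primrec.nat_add.comp bN_primrec Primrec.id
  exact primrec_pow2.comp (Primrec.succ.comp
    (Primrec₂.natPair.comp (Primrec.const 2) (Primrec₂.natPair.comp h h)))

theorem refutable_primrec : PrimrecPred Refutable := by
  obtain ⟨f, hf⟩ := isFrame_primrec
  obtain ⟨g, hg⟩ := isTable_primrec
  have key : ∃ F : BF, ∀ m N n, F.ev [m, N, n + 1, n] ↔ Cert n N m := by
    refine ⟨.and f (.and (.all (.v 2) g) (.ex (.v 1) (.not (bb 1 2 (.v 4) (.v 0))))), ?_⟩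
    intro m N n
    simp only [BF.ev, BF.ev_ex, hf, Tm.ev, Cert, bb]
    simp [hg, B]
  obtain ⟨F, hF⟩ := key
  have h1 : PrimrecRel (fun (m : ℕ) (q : ℕ × ℕ) => F.ev [m, q.1, q.2 + 1, q.2]) := by
    have hq1 : Primrec (fun p : ℕ × ℕ × ℕ => p.2.1) := Primrec.fst.comp Primrec.snd
    have hq2 : Primrec (fun p : ℕ × ℕ × ℕ => p.2.2) := Primrec.snd.comp Primrec.snd
    exact PrimrecPred.comp F.primrec (Primrec.list_cons.comp Primrec.fst
      (Primrec.list_cons.comp hq1 (Primrec.list_cons.comp (Primrec.succ.comp hq2)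
        (Primrec.list_cons.comp hq2 (Primrec.const [])))))
  have h2 : PrimrecRel (fun (N n : ℕ) => ∃ m < bM n, F.ev [m, N, n + 1, n]) := by
    have h1' := exists_lt' h1
    have : PrimrecPred (fun p : ℕ × ℕ => ∃ m < bM p.2, F.ev [m, p.1, p.2 + 1, p.2]) :=
      PrimrecRel.comp (f := fun p : ℕ × ℕ => bM p.2) (g := fun p : ℕ × ℕ => p) h1'
        (bM_primrec.comp Primrec.snd) Primrec.id
    exact this
  have h3 := h2.exists_lt.comp (f := bN) (g := fun n => n) bN_primrec Primrec.id
  refine h3.of_eq fun n => ?_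
  simp only [hF, Refutable]

/-- Model from certificate. -/
def certModel (n N m : ℕ) : KModel.{u} where
  W := ULift.{u} (Fin N)
  fallible := ∅
  le x y := B m 0 x.down y.down
  sq x y := B m 1 x.down y.down
  val i := {x | Nat.pair 0 i ≤ n ∧ B m 2 (Nat.pair 0 i) x.down}

theorem certModel_gs4c {n N m : ℕ} (h : Cert n N m) : (certModel.{u} n N m).IsGS4c := by
  obtain ⟨⟨hr, ht⟩, hT, -⟩ := h
  have ex : ∀ P : ℕ → Prop, (∃ z < N, P z) → ∃ z : ULift.{u} (Fin N), P z.down := by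
    rintro P ⟨z, hz, h⟩; exact ⟨⟨⟨z, hz⟩⟩, h⟩
  have ht' := fun u v w : ULift.{u} (Fin N) =>
    ht u.down u.down.2 v.down v.down.2 w.down w.down.2
  refine ⟨⟨⟨⟨⟨?_, ?_, ?_, ?_, ?_, ?_, ?_, ?_⟩, ?_⟩, ?_, ?_⟩, ?_⟩, ?_⟩
  · exact fun w => (hr w.down w.down.2).1
  · exact fun u v w => (ht' u v w).1
  · exact fun w => (hr w.down w.down.2).2
  · exact fun u v w => (ht' u v w).2.1
  · exact fun w v hw _ => hw.elim
  · exact fun w v hw _ => hw.elim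
  · rintro i w v ⟨h1, h2⟩ hle
    exact ⟨h1, (hT _ (Nat.lt_succ_of_le h1)).1 (by simp) w.down w.down.2 v.down v.down.2 hle h2⟩
  · exact fun i w hw => hw.elim
  · exact fun u v w h1 h2 => ex _ ((ht' u v w).2.2.2.2.1 h1 h2)
  · exact fun u v w h1 h2 => ex _ ((ht' u v w).2.2.2.1 h1 h2)
  · rfl
  · exact fun u v w h1 h2 => (ht' u v w).2.2.1 h1 h2
  · exact fun u v w h1 h2 => ex _ ((ht' u v w).2.2.2.2.2 h1 h2)

theorem certModel_sat {n N m : ℕ} (h : Cert n N m) (ψ : Fml) : ψ.encode ≤ n →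
    ∀ x, (certModel.{u} n N m).Sat ψ x ↔ B m 2 ψ.encode x.down := by
  obtain ⟨-, hT, -⟩ := h
  have binl : ∀ k a b, Nat.pair k (Nat.pair a b) ≤ n → a ≤ n ∧ b ≤ n := fun k a b hk =>
    ⟨(Nat.left_le_pair a b).trans ((Nat.right_le_pair k _).trans hk),
      (Nat.right_le_pair a b).trans ((Nat.right_le_pair k _).trans hk)⟩
  induction ψ with
  | var i => exact fun hn x => ⟨fun hx => hx.2, fun hx => ⟨hn, hx⟩⟩
  | bot =>
    intro hn x
    have := (hT _ (Nat.lt_succ_of_le hn)).2.1 (by simp [Fml.encode]) x.down x.down.2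
    exact ⟨fun hx => hx.elim, fun hx => (this hx).elim⟩
  | and a b iha ihb =>
    intro hn x
    obtain ⟨ha, hb⟩ := binl _ _ _ hn
    have := (hT _ (Nat.lt_succ_of_le hn)).2.2.1 (by simp [Fml.encode]) x.down x.down.2
    simp only [Sat, iha ha, ihb hb, this]
    simp [Fml.encode]
  | or a b iha ihb =>
    intro hn x
    obtain ⟨ha, hb⟩ := binl _ _ _ hn
    have := (hT _ (Nat.lt_succ_of_le hn)).2.2.2.1 (by simp [Fml.encode]) x.down x.down.2
    simp only [Sat, iha ha, ihb hb, this]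
    simp [Fml.encode]
  | imp a b iha ihb =>
    intro hn x
    obtain ⟨ha, hb⟩ := binl _ _ _ hn
    have := (hT _ (Nat.lt_succ_of_le hn)).2.2.2.2.1 (by simp [Fml.encode]) x.down x.down.2
    simp only [Sat, iha ha, ihb hb, this]
    simp only [Fml.encode, Nat.unpair_pair]
    exact ⟨fun h v hv => h ⟨⟨v, hv⟩⟩, fun h v => h v.down v.down.2⟩
  | dia a iha =>
    intro hn x
    have ha : a.encode ≤ n := (Nat.right_le_pair 5 _).trans hn
    have := (hT _ (Nat.lt_succ_of_le hn)).2.2.2.2.2.1 (by simp [Fml.encode]) x.down x.down.2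
    simp only [Sat, iha ha, this]
    simp only [Fml.encode, Nat.unpair_pair]
    constructor
    · intro h v hv hle
      obtain ⟨z, hz⟩ := h ⟨⟨v, hv⟩⟩ hle
      exact ⟨z.down, z.down.2, hz⟩
    · intro h v hle
      obtain ⟨z, hz, h2⟩ := h v.down v.down.2 hle
      exact ⟨⟨⟨z, hz⟩⟩, h2⟩
  | box a iha =>
    intro hn x
    have ha : a.encode ≤ n := (Nat.right_le_pair 6 _).trans hn
    have := (hT _ (Nat.lt_succ_of_le hn)).2.2.2.2.2.2 (by simp [Fml.encode]) x.down x.down.2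
    simp only [Sat, iha ha, this]
    simp only [Fml.encode, Nat.unpair_pair]
    exact ⟨fun h v hv z hz => h ⟨⟨v, hv⟩⟩ ⟨⟨z, hz⟩⟩, fun h v z => h v.down v.down.2 z.down z.down.2⟩

/-- Every bounded predicate is coded by bits of a number. -/
theorem exists_code (K : ℕ) (P : ℕ → Prop) :
    ∃ m < 2 ^ K, ∀ i < K, (m / 2 ^ i % 2 = 1 ↔ P i) := by
  classical
  induction K generalizing P with
  | zero => exact ⟨0, by simp, by simp⟩
  | succ K ih =>
    obtain ⟨m, hm, h⟩ := ih (fun i => P (i + 1))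
    refine ⟨2 * m + (if P 0 then 1 else 0), ?_, ?_⟩
    · rw [pow_succ]; split_ifs <;> omega
    · intro i hi
      cases i with
      | zero => by_cases hP : P 0 <;> simp [hP]
      | succ j =>
        rw [← h j (by omega), pow_succ, mul_comm (2 ^ j) 2, ← Nat.div_div_eq_div_mul]
        have : (2 * m + (if P 0 then 1 else 0)) / 2 = m := by split_ifs <;> omega
        rw [this]

theorem dec_eqs (a : ℕ) :
    (a.unpair.1 = 0 → dec a = .var a.unpair.2) ∧ (a.unpair.1 = 1 → dec a = .bot) ∧
    (a.unpair.1 = 2 → dec a = .and (dec a.unpair.2.unpair.1) (dec a.unpair.2.unpair.2)) ∧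
    (a.unpair.1 = 3 → dec a = .or (dec a.unpair.2.unpair.1) (dec a.unpair.2.unpair.2)) ∧
    (a.unpair.1 = 4 → dec a = .imp (dec a.unpair.2.unpair.1) (dec a.unpair.2.unpair.2)) ∧
    (a.unpair.1 = 5 → dec a = .dia (dec a.unpair.2)) ∧
    (a.unpair.1 = 6 → dec a = .box (dec a.unpair.2)) := by
  refine ⟨?_, ?_, ?_, ?_, ?_, ?_, ?_⟩ <;> intro h <;> rw [dec] <;> simp [h]

theorem cert_of_model (φ : Fml) (M : KModel.{0}) (hM : M.IsGS4c) [Finite M.W]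
    (hc : Nat.card M.W < bN φ.encode) (w : M.W) (hw : ¬ M.Sat φ w) : Refutable φ.encode := by
  classical
  set n := φ.encode with hn
  set N := Nat.card M.W with hN
  let e : M.W ≃ Fin N := Finite.equivFin M.W
  let g : ℕ → M.W := fun i => if h : i < N then e.symm ⟨i, h⟩ else w
  have hg : ∀ x, ∃ i < N, g i = x := fun x => ⟨e x, (e x).2, by simp [g]⟩
  obtain ⟨m, hm, hb⟩ := exists_code (bK n) (fun i =>
    (i.unpair.1 = 0 ∧ M.le (g i.unpair.2.unpair.1) (g i.unpair.2.unpair.2)) ∨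
    (i.unpair.1 = 1 ∧ M.sq (g i.unpair.2.unpair.1) (g i.unpair.2.unpair.2)) ∨
    (i.unpair.1 = 2 ∧ M.Sat (dec i.unpair.2.unpair.1) (g i.unpair.2.unpair.2)))
  have hB : ∀ k a b, k ≤ 2 → a ≤ bN n + n → b ≤ bN n + n → (B m k a b ↔
      ((k = 0 ∧ M.le (g a) (g b)) ∨ (k = 1 ∧ M.sq (g a) (g b)) ∨
        (k = 2 ∧ M.Sat (dec a) (g b)))) := by
    intro k a b hk ha hb'
    have := hb (Nat.pair k (Nat.pair a b))
      (Nat.lt_succ_of_le (le_pair _ _ _ _ hk (le_pair _ _ _ _ ha hb')))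
    simpa [B] using this
  have hle : ∀ a < N, ∀ b < N, (B m 0 a b ↔ M.le (g a) (g b)) := fun a ha b hb => by
    simpa using hB 0 a b (by omega) (by omega) (by omega)
  have hsq : ∀ a < N, ∀ b < N, (B m 1 a b ↔ M.sq (g a) (g b)) := fun a ha b hb => by
    simpa using hB 1 a b (by omega) (by omega) (by omega)
  have hT : ∀ a ≤ n, ∀ b < N, (B m 2 a b ↔ M.Sat (dec a) (g b)) := fun a ha b hb => by
    simpa using hB 2 a b (by omega) (by omega) (by omega)
  have hall : ∀ P : M.W → Prop, (∀ x, P x) ↔ ∀ i < N, P (g i) := fun P =>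
    ⟨fun h i _ => h _, fun h x => by obtain ⟨i, hi, rfl⟩ := hg x; exact h i hi⟩
  have hex : ∀ P : M.W → Prop, (∃ x, P x) ↔ ∃ i < N, P (g i) := fun P =>
    ⟨fun ⟨x, h⟩ => by obtain ⟨i, hi, rfl⟩ := hg x; exact ⟨i, hi, h⟩, fun ⟨i, _, h⟩ => ⟨_, h⟩⟩
  refine ⟨N, hc, m, hm, ?_, ?_, ?_⟩
  · obtain ⟨⟨⟨⟨⟨lr, lt, sr, st, -⟩, bu⟩, fu, inf⟩, lin⟩, fd⟩ := hM
    refine ⟨fun w hw => ⟨(hle w hw w hw).2 (lr _), (hsq w hw w hw).2 (sr _)⟩, ?_⟩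
    intro u hu v hv w hw
    refine ⟨?_, ?_, ?_, ?_, ?_, ?_⟩
    · rw [hle u hu v hv, hle v hv w hw, hle u hu w hw]; exact lt _ _ _
    · rw [hsq u hu v hv, hsq v hv w hw, hsq u hu w hw]; exact st _ _ _
    · rw [hle u hu v hv, hle v hv w hw, hle u hu w hw, hle w hw v hv]; exact lin _ _ _
    · rw [hle u hu v hv, hsq u hu w hw]
      intro h1 h2
      obtain ⟨z, hz, h3, h4⟩ := (hex _).1 (fu _ _ _ h1 h2)
      exact ⟨z, hz, (hle w hw z hz).2 h3, (hsq v hv z hz).2 h4⟩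
    · rw [hsq u hu v hv, hle v hv w hw]
      intro h1 h2
      obtain ⟨z, hz, h3, h4⟩ := (hex _).1 (bu _ _ _ h1 h2)
      exact ⟨z, hz, (hle u hu z hz).2 h3, (hsq z hz w hw).2 h4⟩
    · rw [hle u hu v hv, hsq v hv w hw]
      intro h1 h2
      obtain ⟨z, hz, h3, h4⟩ := (hex _).1 (fd _ _ _ h1 h2)
      exact ⟨z, hz, (hsq u hu z hz).2 h3, (hle z hz w hw).2 h4⟩
  · intro a ha
    have ha : a ≤ n := Nat.le_of_lt_succ ha
    have ha2 : a.unpair.2 ≤ n := (Nat.unpair_right_le a).trans ha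
    have hal : a.unpair.2.unpair.1 ≤ n := (Nat.unpair_left_le _).trans ha2
    have har : a.unpair.2.unpair.2 ≤ n := (Nat.unpair_right_le _).trans ha2
    obtain ⟨d0, d1, d2, d3, d4, d5, d6⟩ := dec_eqs a
    refine ⟨fun h => ?_, fun h => ?_, fun h => ?_, fun h => ?_, fun h => ?_, fun h => ?_,
      fun h => ?_⟩
    · intro w hw v hv
      rw [hle w hw v hv, hT a ha w hw, hT a ha v hv]
      exact fun h => sat_mono hM.1.1.1.1 _ _ _ h
    · intro w hw
      rw [hT a ha w hw, d1 h]
      have := hM.1.1.2.2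
      simp only [Infallible] at this
      simp [Sat, this]
    · intro w hw
      rw [hT a ha w hw, hT _ hal w hw, hT _ har w hw, d2 h]
      rfl
    · intro w hw
      rw [hT a ha w hw, hT _ hal w hw, hT _ har w hw, d3 h]
      rfl
    · intro w hw
      rw [hT a ha w hw, d4 h, Sat, hall]
      refine forall₂_congr fun v hv => ?_
      rw [hle w hw v hv, hT _ hal v hv, hT _ har v hv]
    · intro w hw
      rw [hT a ha w hw, d5 h, Sat, hall]
      refine forall₂_congr fun v hv => ?_
      rw [hle w hw v hv, hex]
      refine imp_congr_right fun _ => exists_congr fun z => and_congr_right fun hz => ?_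
      rw [hsq v hv z hz, hT _ ha2 z hz]
    · intro w hw
      rw [hT a ha w hw, d6 h, Sat, hall]
      refine forall₂_congr fun v hv => ?_
      rw [hall]
      refine forall₂_congr fun z hz => ?_
      rw [hle w hw v hv, hsq v hv z hz, hT _ ha2 z hz]
  · obtain ⟨i, hi, h⟩ := hg w
    refine ⟨i, hi, ?_⟩
    rw [hT n le_rfl i hi, h, hn, dec_encode]
    exact hw

theorem valid_iff (φ : Fml) : GS4cValid.{u} φ ↔ ¬ Refutable φ.encode := by
  constructor
  · rintro hv ⟨N, -, m, -, hC⟩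
    obtain ⟨w, hw, hB⟩ := hC.2.2
    have h1 := hv (certModel.{u} φ.encode N m) ⟨⟨w, hw⟩⟩ (certModel_gs4c hC) (fun h => h)
    exact hB ((certModel_sat hC φ le_rfl _).1 h1)
  · intro hr M w hM _
    by_contra hs
    obtain ⟨v, hv⟩ := fmp M w hM φ
    exact hr (cert_of_model φ _ (fin_gs4c hM _) (Nat.lt_succ_of_le (fin_card M _)) v
      (fun h => hs (hv.1 h)))

end GS4cProof

/-- **The finite birelational frame property for GS4c, and decidability.**
If an `L`-formula `φ` is falsifiable (respectively, satisfiable) on some GS4c frame,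
then `φ` is falsifiable (respectively, satisfiable) on some GS4c frame whose set of
worlds is finite. Consequently, validity on the class of GS4c frames is decidable:
there is a computable function deciding validity through the encoding of formulas
as natural numbers. -/
theorem gs4c_finite_frame_property_and_decidable :
    (∀ φ : Fml,
      ((∃ (M : KModel.{u}) (w : M.W), M.IsGS4c ∧ w ∉ M.fallible ∧ ¬ M.Sat φ w) →
        ∃ (N : KModel.{0}) (v : N.W), N.IsGS4c ∧ Finite N.W ∧ v ∉ N.fallible ∧ ¬ N.Sat φ v) ∧
      ((∃ (M : KModel.{u}) (w : M.W), M.IsGS4c ∧ w ∉ M.fallible ∧ M.Sat φ w) →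
        ∃ (N : KModel.{0}) (v : N.W), N.IsGS4c ∧ Finite N.W ∧ v ∉ N.fallible ∧ N.Sat φ v)) ∧
    (∃ f : ℕ → Bool, Computable f ∧ ∀ φ : Fml, (f φ.encode = true ↔ GS4cValid.{u} φ)) := by
  refine ⟨fun φ => ⟨?_, ?_⟩, ?_⟩
  · rintro ⟨M, w, hM, -, hs⟩
    obtain ⟨v, hv⟩ := GS4cProof.fmp M w hM φ
    exact ⟨_, v, GS4cProof.fin_gs4c hM _, inferInstance, fun h => h, fun h => hs (hv.1 h)⟩
  · rintro ⟨M, w, hM, -, hs⟩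
    obtain ⟨v, hv⟩ := GS4cProof.fmp M w hM φ
    exact ⟨_, v, GS4cProof.fin_gs4c hM _, inferInstance, fun h => h, hv.2 hs⟩
  · classical
    refine ⟨fun n => decide (¬ GS4cProof.Refutable n),
      (PrimrecPred.decide GS4cProof.refutable_primrec.not).to_comp, fun φ => ?_⟩
    rw [decide_eq_true_iff, GS4cProof.valid_iff]
end

section
/- If an L-formula φ is falsifiable (respectively, satisfiable) on some S4I frame, then φ is falsifiable (respectively, satisfiable) on some S4I frame whose set of worlds is finite; that is, the logic S4I has the finite frame property. Consequently, validity on the class of S4I frames is decidable. -/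
universe u

/-- Validity on the class of S4I frames. -/
def S4IValid (φ : Fml) : Prop :=
  ∀ (M : KModel.{u}) (w : M.W), M.IsS4I → w ∉ M.fallible → M.Sat φ w

/-! ### Decoding of formulas -/

theorem aux_lt_pair {a b : ℕ} (h : 1 ≤ a) : b < Nat.pair a b := by
  unfold Nat.pair
  split_ifs
  · nlinarith
  · nlinarith

theorem aux_unpair_lt {c : ℕ} (h : c.unpair.1 ≠ 0) : c.unpair.2 < c := by
  have := aux_lt_pair (a := c.unpair.1) (b := c.unpair.2) (by omega)
  rwa [Nat.pair_unpair] at this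

/-- A total decoding function for formulas. -/
def decFml (c : ℕ) : Fml :=
  if h0 : c.unpair.1 = 0 then .var c.unpair.2
  else
    have h : c.unpair.2 < c := aux_unpair_lt h0
    have _h1 : c.unpair.2.unpair.1 < c := lt_of_le_of_lt (Nat.unpair_left_le _) h
    have _h2 : c.unpair.2.unpair.2 < c := lt_of_le_of_lt (Nat.unpair_right_le _) h
    if c.unpair.1 = 2 then .and (decFml c.unpair.2.unpair.1) (decFml c.unpair.2.unpair.2)
    else if c.unpair.1 = 3 then .or (decFml c.unpair.2.unpair.1) (decFml c.unpair.2.unpair.2)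
    else if c.unpair.1 = 4 then .imp (decFml c.unpair.2.unpair.1) (decFml c.unpair.2.unpair.2)
    else if c.unpair.1 = 5 then .dia (decFml c.unpair.2)
    else if c.unpair.1 = 6 then .box (decFml c.unpair.2)
    else .bot
termination_by c

theorem decFml_0 {c : ℕ} (h : c.unpair.1 = 0) : decFml c = .var c.unpair.2 := by
  rw [decFml]; simp [h]
theorem decFml_1 {c : ℕ} (h : c.unpair.1 = 1) : decFml c = .bot := by
  rw [decFml]; simp [h]
theorem decFml_2 {c : ℕ} (h : c.unpair.1 = 2) :
    decFml c = .and (decFml c.unpair.2.unpair.1) (decFml c.unpair.2.unpair.2) := by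
  rw [decFml]; simp [h]
theorem decFml_3 {c : ℕ} (h : c.unpair.1 = 3) :
    decFml c = .or (decFml c.unpair.2.unpair.1) (decFml c.unpair.2.unpair.2) := by
  rw [decFml]; simp [h]
theorem decFml_4 {c : ℕ} (h : c.unpair.1 = 4) :
    decFml c = .imp (decFml c.unpair.2.unpair.1) (decFml c.unpair.2.unpair.2) := by
  rw [decFml]; simp [h]
theorem decFml_5 {c : ℕ} (h : c.unpair.1 = 5) : decFml c = .dia (decFml c.unpair.2) := by
  rw [decFml]; simp [h]
theorem decFml_6 {c : ℕ} (h : c.unpair.1 = 6) : decFml c = .box (decFml c.unpair.2) := by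
  rw [decFml]; simp [h]

theorem decFml_encode (φ : Fml) : decFml φ.encode = φ := by
  induction φ with
  | var n => rw [Fml.encode, decFml_0] <;> simp
  | bot => rw [Fml.encode, decFml_1]; simp
  | and φ ψ h1 h2 => rw [Fml.encode, decFml_2] <;> simp [h1, h2]
  | or φ ψ h1 h2 => rw [Fml.encode, decFml_3] <;> simp [h1, h2]
  | imp φ ψ h1 h2 => rw [Fml.encode, decFml_4] <;> simp [h1, h2]
  | dia φ h1 => rw [Fml.encode, decFml_5] <;> simp [h1]
  | box φ h1 => rw [Fml.encode, decFml_6] <;> simp [h1]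

theorem aux_pair_le {k a b E : ℕ} (h : Nat.pair k (Nat.pair a b) ≤ E) : a ≤ E ∧ b ≤ E :=
  ⟨(Nat.left_le_pair a b).trans ((Nat.right_le_pair k _).trans h),
   (Nat.right_le_pair a b).trans ((Nat.right_le_pair k _).trans h)⟩

/-! ### Basic facts about satisfaction -/

namespace KModel

theorem sat_mono {M : KModel.{u}} (hM : M.IsBiInt) (ψ : Fml) :
    ∀ w v, M.le w v → M.Sat ψ w → M.Sat ψ v := by
  obtain ⟨_, ht, _, _, hf, _, hv, _⟩ := hM
  induction ψ with
  | var p => intro w v h hs; exact hv p w v hs h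
  | bot => intro w v h hs; exact hf w v hs h
  | and a b iha ihb => intro w v h hs; exact ⟨iha w v h hs.1, ihb w v h hs.2⟩
  | or a b iha ihb => intro w v h hs; exact hs.imp (iha w v h) (ihb w v h)
  | imp a b iha ihb => intro w v h hs x hx; exact hs x (ht _ _ _ h hx)
  | dia a ih => intro w v h hs x hx; exact hs x (ht _ _ _ h hx)
  | box a ih => intro w v h hs x y hx; exact hs x y (ht _ _ _ h hx)

theorem sat_dia {M : KModel.{u}} (hM : M.IsS4I) (ψ : Fml) (w : M.W) :
    M.Sat (.dia ψ) w ↔ ∃ v, M.sq w v ∧ M.Sat ψ v := by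
  constructor
  · intro h; exact h w (hM.1.1 w)
  · rintro ⟨v, hv, hs⟩ u hu
    obtain ⟨v', h1, h2⟩ := hM.2.1 w u v hu hv
    exact ⟨v', h2, sat_mono hM.1 ψ _ _ h1 hs⟩

theorem sat_box {M : KModel.{u}} (hM : M.IsS4I) (ψ : Fml) (w : M.W) :
    M.Sat (.box ψ) w ↔ ∀ v, M.sq w v → M.Sat ψ v := by
  constructor
  · intro h v hv; exact h w v (hM.1.1 w) hv
  · intro h u v hu hv
    obtain ⟨v', h1, h2⟩ := hM.2.2.1 w u v hu hv
    exact sat_mono hM.1 ψ _ _ h2 (h v' h1)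

/-! ### Labels and finite bisimulation types -/

/-- The label of a world: the codes `≤ E` of formulas true at the world. -/
def lab (M : KModel.{u}) (E : ℕ) (w : M.W) : Set (Fin (E + 1)) :=
  {c | M.Sat (decFml c) w}

theorem lab_mono {M : KModel.{u}} (hM : M.IsBiInt) (E : ℕ) {w v : M.W} (h : M.le w v) :
    M.lab E w ⊆ M.lab E v := fun _ hc => sat_mono hM _ _ _ h hc

theorem lab_sat {M : KModel.{u}} {E : ℕ} {w v : M.W} (h : M.lab E w = M.lab E v)
    {ψ : Fml} (hψ : ψ.encode ≤ E) : M.Sat ψ w ↔ M.Sat ψ v := by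
  have := Set.ext_iff.1 h ⟨ψ.encode, by omega⟩
  simpa [lab, decFml_encode] using this

end KModel

/-- Finite types approximating worlds up to depth `k`. -/
def Ty (E : ℕ) : ℕ → Type
  | 0 => Set (Fin (E + 1))
  | k + 1 => Set (Fin (E + 1)) × Set (Ty E k)

/-- The number of types. -/
def tyCard (E : ℕ) (k : ℕ) : ℕ :=
  Nat.rec (2 ^ (E + 1)) (fun _ c => 2 ^ (E + 1) * 2 ^ c) k

theorem Ty_finite (E k : ℕ) : Finite (Ty E k) := by
  induction k with
  | zero => unfold Ty; infer_instance
  | succ k ih => unfold Ty; infer_instance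

theorem Ty_card (E k : ℕ) : Nat.card (Ty E k) = tyCard E k := by
  classical
  induction k with
  | zero =>
    show Nat.card (Set (Fin (E + 1))) = 2 ^ (E + 1)
    rw [Nat.card_eq_fintype_card]; simp
  | succ k ih =>
    show Nat.card (Set (Fin (E + 1)) × Set (Ty E k)) = 2 ^ (E + 1) * 2 ^ tyCard E k
    have := Ty_finite E k
    have := Fintype.ofFinite (Ty E k)
    rw [← ih, Nat.card_prod, Nat.card_eq_fintype_card, Nat.card_eq_fintype_card,
      Nat.card_eq_fintype_card]
    simp

namespace KModel

/-- The type of depth `k` of a world. -/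
def ty (M : KModel.{u}) (E : ℕ) : (k : ℕ) → M.W → Ty E k
  | 0, w => M.lab E w
  | k + 1, w => (M.lab E w, {t | ∃ w', M.le w w' ∧ M.lab E w ≠ M.lab E w' ∧ M.ty E k w' = t})

theorem ty_lab {M : KModel.{u}} {E k : ℕ} {w v : M.W} (h : M.ty E k w = M.ty E k v) :
    M.lab E w = M.lab E v := by
  cases k with
  | zero => exact h
  | succ k => exact congrArg Prod.fst h

theorem ty_back {M : KModel.{u}} {E k : ℕ} {w v : M.W} (h : M.ty E (k + 1) w = M.ty E (k + 1) v)
    {w' : M.W} (hw : M.le w w') (hl : M.lab E w ≠ M.lab E w') :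
    ∃ v', M.le v v' ∧ M.lab E v ≠ M.lab E v' ∧ M.ty E k v' = M.ty E k w' := by
  have h2 := congrArg Prod.snd h
  have : M.ty E k w' ∈ {t | ∃ w', M.le w w' ∧ M.lab E w ≠ M.lab E w' ∧ M.ty E k w' = t} :=
    ⟨w', hw, hl, rfl⟩
  exact (Set.ext_iff.1 h2 (M.ty E k w')).1 this

theorem lab_card_lt {M : KModel.{u}} (hM : M.IsBiInt) {E : ℕ} {w v : M.W} (h : M.le w v)
    (hl : M.lab E w ≠ M.lab E v) : (M.lab E w).ncard < (M.lab E v).ncard :=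
  Set.ncard_lt_ncard ((lab_mono hM E h).ssubset_of_ne hl) (Set.toFinite _)

theorem lab_card_le {M : KModel.{u}} {E : ℕ} (w : M.W) : (M.lab E w).ncard ≤ E + 1 := by
  have := Set.ncard_le_card (M.lab E w)
  simpa using this

theorem ty_step {M : KModel.{u}} (hM : M.IsBiInt) {E : ℕ} (k : ℕ) :
    ∀ w v : M.W, E + 1 ≤ k + (M.lab E w).ncard → M.ty E k w = M.ty E k v →
      M.ty E (k + 1) w = M.ty E (k + 1) v := by
  induction k with
  | zero =>
    intro w v hc h
    have hl := ty_lab h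
    have key : ∀ w : M.W, E + 1 ≤ (M.lab E w).ncard →
        {t | ∃ w', M.le w w' ∧ M.lab E w ≠ M.lab E w' ∧ M.ty E 0 w' = t} = ∅ := by
      intro w hc
      ext t
      simp only [Set.mem_ofPred_eq, Set.mem_empty_iff_false, iff_false]
      rintro ⟨w', h1, h2, -⟩
      have := lab_card_lt hM h1 h2
      have := lab_card_le (E := E) w'
      omega
    refine Prod.ext hl ?_
    refine (key w (by omega)).trans (key v ?_).symm
    rw [← hl]; omega
  | succ k ih =>
    have half : ∀ w v : M.W, E + 1 ≤ k + 1 + (M.lab E w).ncard →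
        M.ty E (k + 1) w = M.ty E (k + 1) v → 
        {t | ∃ w', M.le w w' ∧ M.lab E w ≠ M.lab E w' ∧ M.ty E (k + 1) w' = t} ⊆
        {t | ∃ w', M.le v w' ∧ M.lab E v ≠ M.lab E w' ∧ M.ty E (k + 1) w' = t} := by
      rintro w v hc h t ⟨w', h1, h2, rfl⟩
      obtain ⟨v', h3, h4, h5⟩ := ty_back h h1 h2
      have := lab_card_lt hM h1 h2
      exact ⟨v', h3, h4, (ih w' v' (by omega) h5.symm).symm⟩
    intro w v hc h
    have hl := ty_lab h
    refine Prod.ext hl (Set.Subset.antisymm (half w v hc h) (half v w ?_ h.symm))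
    rw [← hl]; exact hc

/-- The full type. -/
def fty (M : KModel.{u}) (E : ℕ) (w : M.W) : Ty E (E + 1) := M.ty E (E + 1) w

theorem fty_lab {M : KModel.{u}} {E : ℕ} {w v : M.W} (h : M.fty E w = M.fty E v) :
    M.lab E w = M.lab E v := ty_lab h

theorem fty_back {M : KModel.{u}} (hM : M.IsBiInt) {E : ℕ} {w v : M.W}
    (h : M.fty E w = M.fty E v) {w' : M.W} (hw : M.le w w') (hl : M.lab E w ≠ M.lab E w') :
    ∃ v', M.le v v' ∧ M.lab E v ≠ M.lab E v' ∧ M.fty E v' = M.fty E w' :=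
  ty_back (ty_step hM (E + 1) w v (by omega) h) hw hl

/-! ### Chains -/

/-- Chains with strictly increasing labels (top element first). -/
inductive Ch (M : KModel.{u}) (E : ℕ) : List M.W → Prop
  | single (w) : Ch M E [w]
  | cons {w' w a} : Ch M E (w :: a) → M.le w w' → M.lab E w ≠ M.lab E w' → Ch M E (w' :: w :: a)

/-- One-step modal relation between chains. -/
inductive St (M : KModel.{u}) (E : ℕ) : List M.W → List M.W → Prop
  | single {w v} : M.sq w v → St M E [w] [v]
  | collapse {w' w a v b c} : St M E (w :: a) (v :: b) → M.sq w' c → M.le v c →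
      M.lab E v = M.lab E c → St M E (w' :: w :: a) (v :: b)
  | extend {w' w a v' v b} : St M E (w :: a) (v :: b) → M.sq w' v' → M.le v v' →
      M.lab E v ≠ M.lab E v' → St M E (w' :: w :: a) (v' :: v :: b)

variable {M : KModel.{u}} {E : ℕ}

theorem Ch.ne_nil {a : List M.W} (h : Ch M E a) : a ≠ [] := by cases h <;> simp

theorem St.ch {a b : List M.W} (h : St M E a b) : Ch M E b := by
  induction h with
  | single _ => exact .single _
  | collapse _ _ _ _ ih => exact ih
  | extend _ _ h1 h2 ih => exact .cons ih h1 h2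

theorem St.head (hM : M.IsBiInt) {a b : List M.W} (h : St M E a b) :
    ∃ w a' v b' c, a = w :: a' ∧ b = v :: b' ∧ M.sq w c ∧ M.le v c ∧ M.lab E v = M.lab E c := by
  cases h with
  | single h => exact ⟨_, _, _, _, _, rfl, rfl, h, hM.1 _, rfl⟩
  | collapse _ h1 h2 h3 => exact ⟨_, _, _, _, _, rfl, rfl, h1, h2, h3⟩
  | extend _ h1 h2 h3 => exact ⟨_, _, _, _, _, rfl, rfl, h1, hM.1 _, rfl⟩

theorem Ch.suffix {a : List M.W} (h : Ch M E a) : ∀ b, b ≠ [] → b <:+ a → Ch M E b := by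
  induction h with
  | single w =>
    intro b hb h
    rcases List.suffix_cons_iff.1 h with rfl | h
    · exact .single _
    · simp_all
  | cons h1 h2 h3 ih =>
    intro b hb h
    rcases List.suffix_cons_iff.1 h with rfl | h
    · exact .cons h1 h2 h3
    · exact ih b hb h

theorem Ch.head_le (hM : M.IsBiInt) {a : List M.W} (h : Ch M E a) :
    ∀ w b, (w :: b) <:+ a → ∃ u c, a = u :: c ∧ M.le w u := by
  induction h with
  | single w =>
    intro v b h
    rcases List.suffix_cons_iff.1 h with h | h
    · exact ⟨w, [], rfl, by obtain ⟨rfl, -⟩ := List.cons.inj h; exact hM.1 _⟩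
    · simp at h
  | cons h1 h2 h3 ih =>
    intro v b h
    rcases List.suffix_cons_iff.1 h with h | h
    · exact ⟨_, _, rfl, by obtain ⟨rfl, -⟩ := List.cons.inj h; exact hM.1 _⟩
    · obtain ⟨u, c, hu, hle⟩ := ih v b h
      obtain ⟨rfl, -⟩ := List.cons.inj hu
      exact ⟨_, _, rfl, hM.2.1 _ _ _ hle h2⟩

theorem Ch.length_le (hM : M.IsBiInt) {a : List M.W} (h : Ch M E a) :
    a.length ≤ E + 2 := by
  suffices ∃ w b, a = w :: b ∧ b.length ≤ (M.lab E w).ncard by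
    obtain ⟨w, b, rfl, h⟩ := this
    have := lab_card_le (E := E) w
    simp; omega
  induction h with
  | single w => exact ⟨w, [], rfl, by simp⟩
  | cons h1 h2 h3 ih =>
    obtain ⟨w, b, hb, h⟩ := ih
    obtain ⟨rfl, rfl⟩ := List.cons.inj hb
    have := lab_card_lt hM h2 h3
    exact ⟨_, _, rfl, by simp; omega⟩

theorem St.up (hM : M.IsS4I) {a' : List M.W} (h : Ch M E a') :
    ∀ a b, St M E a b → a <:+ a' → ∃ b', St M E a' b' ∧ b <:+ b' := by
  induction h with
  | single w =>
    intro a b hab h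
    rcases List.suffix_cons_iff.1 h with rfl | h
    · exact ⟨b, hab, List.suffix_refl _⟩
    · obtain ⟨_, _, _, _, _, rfl, _⟩ := hab.head hM.1
      simp at h
  | @cons w' w a0 h1 h2 h3 ih =>
    intro a b hab h
    rcases List.suffix_cons_iff.1 h with rfl | h
    · exact ⟨b, hab, List.suffix_refl _⟩
    · obtain ⟨b', hs, hb⟩ := ih a b hab h
      obtain ⟨w1, a1, v, b1, c, e, rfl, hwc, hvc, hl⟩ := hs.head hM.1
      obtain ⟨rfl, rfl⟩ := List.cons.inj e
      obtain ⟨c', hc1, hc2⟩ := hM.2.1 _ _ _ h2 hwc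
      have hvc' := hM.1.2.1 _ _ _ hvc hc1
      by_cases hq : M.lab E v = M.lab E c'
      · exact ⟨_, .collapse hs hc2 hvc' hq, hb⟩
      · exact ⟨_, .extend hs hc2 hvc' hq, hb.trans (List.suffix_cons _ _)⟩

theorem St.down {a' b' : List M.W} (h : St M E a' b') :
    ∀ a, a ≠ [] → a <:+ a' → ∃ b, St M E a b ∧ b <:+ b' := by
  induction h with
  | single h =>
    intro a ha hs
    rcases List.suffix_cons_iff.1 hs with rfl | hs
    · exact ⟨_, .single h, List.suffix_refl _⟩
    · simp_all
  | collapse h h1 h2 h3 ih =>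
    intro a ha hs
    rcases List.suffix_cons_iff.1 hs with rfl | hs
    · exact ⟨_, .collapse h h1 h2 h3, List.suffix_refl _⟩
    · exact ih a ha hs
  | extend h h1 h2 h3 ih =>
    intro a ha hs
    rcases List.suffix_cons_iff.1 hs with rfl | hs
    · exact ⟨_, .extend h h1 h2 h3, List.suffix_refl _⟩
    · obtain ⟨b, hb, hb'⟩ := ih a ha hs
      exact ⟨b, hb, hb'.trans (List.suffix_cons _ _)⟩

theorem Ch.succ (hM : M.IsS4I) {a : List M.W} (h : Ch M E a) :
    ∀ w a0 v, a = w :: a0 → M.sq w v →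
      ∃ v0 b, St M E a (v0 :: b) ∧ M.le v0 v ∧ M.lab E v0 = M.lab E v := by
  induction h with
  | single w =>
    intro w1 a0 v e hv
    obtain ⟨rfl, rfl⟩ := List.cons.inj e
    exact ⟨v, [], .single hv, hM.1.1 _, rfl⟩
  | cons h1 h2 h3 ih =>
    intro w1 a0 v e hv
    obtain ⟨rfl, rfl⟩ := List.cons.inj e
    obtain ⟨x, hx1, hx2⟩ := hM.2.2.1 _ _ _ h2 hv
    obtain ⟨v0, b, hs, hle, -⟩ := ih _ _ x rfl hx1
    have hle' := hM.1.2.1 _ _ _ hle hx2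
    by_cases hq : M.lab E v0 = M.lab E v
    · exact ⟨_, _, .collapse hs hv hle' hq, hle', hq⟩
    · exact ⟨_, _, .extend hs hv hle' hq, hM.1.1 _, rfl⟩

theorem Ch.lift (hM : M.IsBiInt) {a d : List M.W} (ha : Ch M E a) (hd : Ch M E d) :
    a.map (M.fty E) <:+ d.map (M.fty E) →
      ∃ a', Ch M E a' ∧ a <:+ a' ∧ a'.map (M.fty E) = d.map (M.fty E) := by
  induction hd with
  | single w =>
    intro h
    rcases List.suffix_cons_iff.1 h with h | h
    · exact ⟨a, ha, List.suffix_refl _, h⟩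
    · have := ha.ne_nil
      simp_all
  | @cons w' w d0 h1 h2 h3 ih =>
    intro h
    rcases List.suffix_cons_iff.1 h with h | h
    · exact ⟨a, ha, List.suffix_refl _, h⟩
    · obtain ⟨a', hc, hs, he⟩ := ih h
      cases a' with
      | nil => simp at he
      | cons x a1 =>
        obtain ⟨e1, e2⟩ := List.cons.inj he
        obtain ⟨y, hy1, hy2, hy3⟩ := fty_back hM e1.symm h2 h3
        refine ⟨y :: x :: a1, .cons hc hy1 hy2, hs.trans (List.suffix_cons _ _), ?_⟩
        rw [List.map_cons, he, hy3]; rfl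

/-! ### The finite model -/

/-- The one-step relation on worlds of the finite model. -/
def finStep (M : KModel.{u}) (E : ℕ)
    (x y : {l : List (Ty E (E + 1)) // ∃ a, Ch M E a ∧ a.map (M.fty E) = l}) : Prop :=
  ∃ a b, Ch M E a ∧ a.map (M.fty E) = x.1 ∧ b.map (M.fty E) = y.1 ∧ St M E a b

/-- The finite model. -/
def fin (M : KModel.{u}) (E : ℕ) : KModel.{0} where
  W := {l : List (Ty E (E + 1)) // ∃ a, Ch M E a ∧ a.map (M.fty E) = l}
  fallible := ∅
  le x y := x.1 <:+ y.1
  sq := Relation.ReflTransGen (finStep M E)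
  val p := {x | ∃ w a, Ch M E (w :: a) ∧ (w :: a).map (M.fty E) = x.1 ∧ w ∈ M.val p}

/-- Lifting of an extension to realizing chains. -/
theorem fin_lift (hM : M.IsBiInt) {x y : (M.fin E).W} (h : (M.fin E).le x y) {w a}
    (ha : Ch M E (w :: a)) (hx : (w :: a).map (M.fty E) = x.1) :
    ∃ u c, Ch M E (u :: c) ∧ (w :: a) <:+ (u :: c) ∧ (u :: c).map (M.fty E) = y.1 ∧ M.le w u := by
  obtain ⟨d, hd, hd'⟩ := y.2
  have h' : x.1 <:+ y.1 := h
  rw [← hx, ← hd'] at h'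
  obtain ⟨a', h1, h2, h3⟩ := ha.lift hM hd h'
  obtain ⟨u, c, rfl, hle⟩ := h1.head_le hM _ _ h2
  exact ⟨u, c, h1, h2, h3.trans hd', hle⟩

theorem fin_up (hM : M.IsS4I) : (M.fin E).ForthUp := by
  intro x x' y hle hsq
  induction hsq with
  | refl => exact ⟨x', hle, Relation.ReflTransGen.refl⟩
  | @tail y z _ hstep ih =>
    obtain ⟨y', hy1, hy2⟩ := ih
    obtain ⟨a, b, ha, hay, hbz, hst⟩ := hstep
    obtain ⟨w, a0, v, b0, c, rfl, rfl, -⟩ := hst.head hM.1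
    obtain ⟨u, c, h1, h2, h3, h4⟩ := fin_lift hM.1 hy1 ha hay
    obtain ⟨b', hb1, hb2⟩ := St.up hM h1 _ _ hst h2
    refine ⟨⟨b'.map (M.fty E), b', hb1.ch, rfl⟩, ?_, hy2.tail ⟨_, b', h1, h3, rfl, hb1⟩⟩
    show z.1 <:+ _
    rw [← hbz]
    exact hb2.map _

theorem fin_down : (M.fin E).ForthDown := by
  intro x y y' hle hsq
  induction hsq using Relation.ReflTransGen.head_induction_on generalizing x with
  | refl => exact ⟨x, Relation.ReflTransGen.refl, hle⟩
  | @head y z hstep _ ih =>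
    obtain ⟨a, b, ha, hay, hbz, hst⟩ := hstep
    have h' : x.1 <:+ y.1 := hle
    rw [← hay] at h'
    obtain ⟨a', ha', hx⟩ := List.suffix_map_iff.1 h'
    have hne : a' ≠ [] := by
      rintro rfl
      obtain ⟨d, hd, hd'⟩ := x.2
      have := hd.ne_nil
      simp_all
    obtain ⟨b', hb1, hb2⟩ := hst.down a' hne ha'
    have hz : (M.fin E).le ⟨b'.map (M.fty E), b', hb1.ch, rfl⟩ z := by
      show _ <:+ z.1
      rw [← hbz]
      exact hb2.map _
    obtain ⟨x', h1, h2⟩ := ih _ hz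
    exact ⟨x', Relation.ReflTransGen.head ⟨a', b', ha.suffix _ hne ha', hx.symm, rfl, hb1⟩ h1, h2⟩

theorem fin_S4I (hM : M.IsS4I) : (M.fin E).IsS4I := by
  refine ⟨⟨fun w => List.suffix_refl _, fun _ _ _ h1 h2 => List.IsSuffix.trans h1 h2,
    fun _ => .refl, fun _ _ _ h1 h2 => Relation.ReflTransGen.trans h1 h2,
    fun _ _ h => h.elim, fun _ _ h => h.elim, ?_, fun _ _ h => h.elim⟩, fin_up hM, fin_down, rfl⟩
  rintro p x y ⟨w, a, ha, hx, hw⟩ hle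
  obtain ⟨u, c, h1, h2, h3, h4⟩ := fin_lift hM.1 hle ha hx
  exact ⟨u, c, h1, h3, hM.1.2.2.2.2.2.2.1 p _ _ hw h4⟩

theorem fin_lab {w w' : M.W} {a a' : List M.W}
    (h : (w :: a).map (M.fty E) = (w' :: a').map (M.fty E)) : M.lab E w = M.lab E w' :=
  fty_lab (List.cons.inj h).1

theorem fin_box (hM : M.IsS4I) {ψ : Fml} (hψ : (Fml.box ψ).encode ≤ E) {x y : (M.fin E).W}
    (h : (M.fin E).sq x y)
    (hx : ∀ w a, Ch M E (w :: a) → (w :: a).map (M.fty E) = x.1 → M.Sat (.box ψ) w) :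
    ∀ w a, Ch M E (w :: a) → (w :: a).map (M.fty E) = y.1 → M.Sat (.box ψ) w := by
  induction h with
  | refl => exact hx
  | @tail y z _ hstep ih =>
    intro w a hwa hz
    obtain ⟨a, b, ha, hay, hbz, hst⟩ := hstep
    obtain ⟨w1, a1, v, b1, c, rfl, rfl, h1, h2, h3⟩ := hst.head hM.1
    rw [lab_sat ((fin_lab (hz.trans hbz.symm)).trans h3) hψ]
    have := ih _ _ ha hay
    rw [sat_box hM] at this ⊢
    exact fun v hv => this v (hM.1.2.2.2.1 _ _ _ h1 hv)

theorem fin_dia (hM : M.IsS4I) {ψ : Fml} (hψ : (Fml.dia ψ).encode ≤ E) {x y : (M.fin E).W}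
    (h : (M.fin E).sq x y)
    (hy : ∀ w a, Ch M E (w :: a) → (w :: a).map (M.fty E) = y.1 → M.Sat (.dia ψ) w) :
    ∀ w a, Ch M E (w :: a) → (w :: a).map (M.fty E) = x.1 → M.Sat (.dia ψ) w := by
  induction h using Relation.ReflTransGen.head_induction_on with
  | refl => exact hy
  | @head y z hstep _ ih =>
    intro w a hwa hy
    obtain ⟨a, b, ha, hay, hbz, hst⟩ := hstep
    have hb := hst.ch
    obtain ⟨w1, a1, v, b1, c, rfl, rfl, h1, h2, h3⟩ := hst.head hM.1
    rw [lab_sat ((fin_lab (hy.trans hay.symm))) hψ]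
    have := ih _ _ hb hbz
    rw [lab_sat h3 hψ] at this
    rw [sat_dia hM] at this ⊢
    obtain ⟨v, hv, hs⟩ := this
    exact ⟨v, hM.1.2.2.2.1 _ _ _ h1 hv, hs⟩

theorem fin_truth (hM : M.IsS4I) (ψ : Fml) : ψ.encode ≤ E → ∀ (x : (M.fin E).W) w a,
    Ch M E (w :: a) → (w :: a).map (M.fty E) = x.1 → ((M.fin E).Sat ψ x ↔ M.Sat ψ w) := by
  induction ψ with
  | var p =>
    intro hE x w a ha hx
    constructor
    · rintro ⟨w', a', ha', hx', hw'⟩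
      exact (lab_sat (fin_lab (hx.trans hx'.symm)) hE).2 hw'
    · intro h
      exact ⟨w, a, ha, hx, h⟩
  | bot =>
    intro hE x w a ha hx
    constructor
    · intro h; exact h.elim
    · intro h
      have h' : w ∈ M.fallible := h
      rw [hM.2.2.2] at h'
      exact h'.elim
  | and ψ χ ih1 ih2 =>
    intro hE x w a ha hx
    have hE' := aux_pair_le hE
    exact and_congr (ih1 hE'.1 x w a ha hx) (ih2 hE'.2 x w a ha hx)
  | or ψ χ ih1 ih2 =>
    intro hE x w a ha hx
    have hE' := aux_pair_le hE
    exact or_congr (ih1 hE'.1 x w a ha hx) (ih2 hE'.2 x w a ha hx)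
  | imp ψ χ ih1 ih2 =>
    intro hE x w a ha hx
    have hE' := aux_pair_le hE
    constructor
    · intro h v hwv hv
      by_cases hl : M.lab E w = M.lab E v
      · rw [← lab_sat hl hE'.2, ← ih2 hE'.2 x w a ha hx]
        refine h x (List.suffix_refl _) ?_
        rwa [ih1 hE'.1 x w a ha hx, lab_sat hl hE'.1]
      · have hc := ha.cons hwv hl
        rw [← ih2 hE'.2 ⟨_, _, hc, rfl⟩ _ _ hc rfl]
        refine h _ ?_ ((ih1 hE'.1 ⟨_, _, hc, rfl⟩ _ _ hc rfl).2 hv)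
        show x.1 <:+ _
        rw [← hx]
        exact List.suffix_cons _ _
    · intro h y hxy hy
      obtain ⟨v, c, h1, h2, h3, h4⟩ := fin_lift hM.1 hxy ha hx
      rw [ih2 hE'.2 y v c h1 h3]
      rw [ih1 hE'.1 y v c h1 h3] at hy
      exact h v h4 hy
  | dia ψ ih =>
    intro hE x w a ha hx
    have hE' : ψ.encode ≤ E := (Nat.right_le_pair 5 _).trans hE
    constructor
    · intro h
      obtain ⟨y, hxy, hy⟩ := h x (List.suffix_refl _)
      refine fin_dia hM hE hxy (fun v b hb hb' => ?_) w a ha hx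
      rw [ih hE' y v b hb hb'] at hy
      rw [sat_dia hM]
      exact ⟨v, hM.1.2.2.1 _, hy⟩
    · intro h y hxy
      obtain ⟨v, c, h1, h2, h3, h4⟩ := fin_lift hM.1 hxy ha hx
      obtain ⟨z, hz, hz'⟩ := (sat_dia hM ψ v).1 (sat_mono hM.1 _ _ _ h4 h)
      obtain ⟨v0, b, hs, hle, hl⟩ := h1.succ hM _ _ z rfl hz
      refine ⟨⟨_, _, hs.ch, rfl⟩, .single ⟨_, _, h1, h3, rfl, hs⟩, ?_⟩
      exact (ih hE' ⟨_, _, hs.ch, rfl⟩ _ _ hs.ch rfl).2 ((lab_sat hl hE').2 hz')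
  | box ψ ih =>
    intro hE x w a ha hx
    have hE' : ψ.encode ≤ E := (Nat.right_le_pair 6 _).trans hE
    constructor
    · intro h
      rw [sat_box hM]
      intro z hz
      obtain ⟨v0, b, hs, hle, hl⟩ := ha.succ hM _ _ z rfl hz
      rw [← lab_sat hl hE', ← ih hE' ⟨_, _, hs.ch, rfl⟩ _ _ hs.ch rfl]
      exact h x _ (List.suffix_refl _) (.single ⟨_, _, ha, hx, rfl, hs⟩)
    · intro h y z hxy hyz
      obtain ⟨v, c, h1, h2, h3, h4⟩ := fin_lift hM.1 hxy ha hx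
      obtain ⟨d, hd, hd'⟩ := z.2
      cases d with
      | nil => exact absurd rfl hd.ne_nil
      | cons u d =>
        rw [ih hE' z u d hd hd']
        refine (sat_box hM _ _).1 (fin_box hM hE hyz (fun v' c' h1' h3' => ?_) u d hd hd') u
          (hM.1.2.2.1 _)
        rw [lab_sat (fin_lab (h3'.trans h3.symm)) hE]
        exact sat_mono hM.1 _ _ _ h4 h

/-- Bound on the size of the finite model. -/
def _root_.sizeBound (E : ℕ) : ℕ := (tyCard E (E + 1) + 1) ^ (E + 2)

theorem fin_card (hM : M.IsBiInt) :
    Finite (M.fin E).W ∧ Nat.card (M.fin E).W ≤ sizeBound E := by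
  classical
  have := Ty_finite E (E + 1)
  let f : (M.fin E).W → (Fin (E + 2) → Option (Ty E (E + 1))) := fun x i => x.1[(i : ℕ)]?
  have hf : Function.Injective f := by
    intro x y h
    have hlen : ∀ x : (M.fin E).W, x.1.length ≤ E + 2 := by
      intro x
      obtain ⟨a, ha, hx⟩ := x.2
      rw [← hx, List.length_map]
      exact ha.length_le hM
    apply Subtype.ext
    apply List.ext_getElem?
    intro i
    by_cases hi : i < E + 2
    · exact congrFun h ⟨i, hi⟩
    · have h1 := hlen x
      have h2 := hlen y
      rw [List.getElem?_eq_none (by omega), List.getElem?_eq_none (by omega)]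
  refine ⟨Finite.of_injective f hf, (Nat.card_le_card_of_injective f hf).trans ?_⟩
  rw [Nat.card_fun, Finite.card_option, Ty_card]
  simp [sizeBound]

theorem fmp (hM : M.IsS4I) (φ : Fml) (w : M.W) :
    ∃ (N : KModel.{0}) (v : N.W), N.IsS4I ∧ Finite N.W ∧ Nat.card N.W ≤ sizeBound φ.encode ∧
      (N.Sat φ v ↔ M.Sat φ w) := by
  refine ⟨M.fin φ.encode, ⟨_, _, Ch.single w, rfl⟩, fin_S4I hM, (fin_card hM.1).1,
    (fin_card hM.1).2, fin_truth hM φ le_rfl _ _ _ (.single w) rfl⟩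

end KModel

/-! ### Coded finite models -/

/-- The `i`-th binary digit of `m` is one. -/
def nbit (m i : ℕ) : Prop := m / 2 ^ i % 2 = 1

theorem exists_nbit (N : ℕ) : ∀ p : ℕ → Prop, ∃ m < 2 ^ N, ∀ i < N, (nbit m i ↔ p i) := by
  induction N with
  | zero => intro p; exact ⟨0, by simp, by simp⟩
  | succ N ih =>
    intro p
    obtain ⟨m, hm, h⟩ := ih (fun i => p (i + 1))
    have key : ∀ b < 2, (b = 1 ↔ p 0) →
        ∃ m < 2 ^ (N + 1), ∀ i < N + 1, (nbit m i ↔ p i) := by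
      intro b hb hp
      refine ⟨2 * m + b, by rw [pow_succ]; omega, ?_⟩
      intro i hi
      cases i with
      | zero => unfold nbit; rw [← hp]; simp; omega
      | succ i =>
        rw [← h i (by omega)]
        unfold nbit
        rw [pow_succ', ← Nat.div_div_eq_div_mul]
        have : (2 * m + b) / 2 = m := by omega
        rw [this]
    by_cases hp : p 0
    · exact key 1 (by omega) (by simp [hp])
    · exact key 0 (by omega) (by simp [hp])

/-- The binary relation coded by `m`. -/
def rbit (m i j : ℕ) : Prop := nbit m (Nat.pair i j)

theorem exists_rbit (A B : ℕ) (p : ℕ → ℕ → Prop) :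
    ∃ m < 2 ^ ((A + B + 1) * (A + B + 1)), ∀ i < A, ∀ j < B, (rbit m i j ↔ p i j) := by
  obtain ⟨m, hm, h⟩ := exists_nbit ((A + B + 1) * (A + B + 1)) (fun c => p c.unpair.1 c.unpair.2)
  refine ⟨m, hm, fun i hi j hj => ?_⟩
  have h1 := Nat.pair_lt_max_add_one_sq i j
  have h2 : (max i j + 1) ^ 2 ≤ (A + B + 1) * (A + B + 1) := by
    rw [sq]
    have : max i j + 1 ≤ A + B + 1 := by omega
    exact Nat.mul_le_mul this this
  have := h (Nat.pair i j) (by omega)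
  simpa [rbit] using this

/-- Frame conditions for a coded frame. -/
def frameOK (n l s : ℕ) : Prop :=
  (∀ i < n, rbit l i i ∧ rbit s i i) ∧
  (∀ i < n, ∀ j < n, ∀ k < n, (rbit l i j → rbit l j k → rbit l i k) ∧
    (rbit s i j → rbit s j k → rbit s i k) ∧
    (rbit l i j → rbit s i k → ∃ x < n, rbit l k x ∧ rbit s j x) ∧
    (rbit l i j → rbit s j k → ∃ x < n, rbit s i x ∧ rbit l x k))

/-- Local truth conditions for a coded labelled model. -/
def labOK (n l s t c w : ℕ) : Prop :=
  (c.unpair.1 = 0 → ∀ v < n, rbit t w c → rbit l w v → rbit t v c) ∧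
  (c.unpair.1 = 1 → ¬ rbit t w c) ∧
  (c.unpair.1 = 2 → (rbit t w c ↔ rbit t w c.unpair.2.unpair.1 ∧ rbit t w c.unpair.2.unpair.2)) ∧
  (c.unpair.1 = 3 → (rbit t w c ↔ rbit t w c.unpair.2.unpair.1 ∨ rbit t w c.unpair.2.unpair.2)) ∧
  (c.unpair.1 = 4 → (rbit t w c ↔ ∀ v < n, rbit l w v →
    rbit t v c.unpair.2.unpair.1 → rbit t v c.unpair.2.unpair.2)) ∧
  (c.unpair.1 = 5 → (rbit t w c ↔ ∀ v < n, rbit l w v → ∃ x < n, rbit s v x ∧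
    rbit t x c.unpair.2)) ∧
  (c.unpair.1 = 6 → (rbit t w c ↔ ∀ v < n, ∀ x < n, rbit l w v → rbit s v x →
    rbit t x c.unpair.2))

/-- A coded model refuting the formula with code `E`. -/
def codeOK (E n l s t : ℕ) : Prop :=
  frameOK n l s ∧ (∀ c < E + 1, ∀ w < n, labOK n l s t c w) ∧ ∃ w < n, ¬ rbit t w E

/-- The bound on codes. -/
def codeBound (E : ℕ) : ℕ :=
  2 ^ ((sizeBound E + (sizeBound E + E + 1) + 1) * (sizeBound E + (sizeBound E + E + 1) + 1))

/-- There is a small coded model refuting the formula with code `E`. -/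
def codedRefutable (E : ℕ) : Prop :=
  ∃ n < sizeBound E + 1, ∃ l < codeBound E, ∃ s < codeBound E, ∃ t < codeBound E,
    codeOK E n l s t

/-- The model given by a code. -/
def codeModel (E n l s t : ℕ) : KModel.{u} where
  W := ULift.{u} (Fin n)
  fallible := ∅
  le i j := rbit l i.down j.down
  sq i j := rbit s i.down j.down
  val p := {i | Nat.pair 0 p ≤ E ∧ rbit t i.down (Nat.pair 0 p)}

theorem codeModel_S4I {E n l s t : ℕ} (h : codeOK E n l s t) :
    (codeModel.{u} E n l s t).IsS4I := by
  obtain ⟨⟨h1, h2⟩, h3, -⟩ := h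
  refine ⟨⟨fun w => (h1 _ w.down.2).1, fun a b c => (h2 _ a.down.2 _ b.down.2 _ c.down.2).1,
    fun w => (h1 _ w.down.2).2, fun a b c => (h2 _ a.down.2 _ b.down.2 _ c.down.2).2.1,
    fun _ _ h => h.elim, fun _ _ h => h.elim, ?_, fun _ _ h => h.elim⟩, ?_, ?_, rfl⟩
  · rintro p w v ⟨hp, hw⟩ hle
    exact ⟨hp, (h3 _ (by omega) _ w.down.2).1 (by simp) _ v.down.2 hw hle⟩
  · intro a b c hab hac
    obtain ⟨x, hx, hx'⟩ := (h2 _ a.down.2 _ b.down.2 _ c.down.2).2.2.1 hab hac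
    exact ⟨⟨⟨x, hx⟩⟩, hx'⟩
  · intro a b c hab hac
    obtain ⟨x, hx, hx'⟩ := (h2 _ a.down.2 _ b.down.2 _ c.down.2).2.2.2 hab hac
    exact ⟨⟨⟨x, hx⟩⟩, hx'⟩

theorem codeModel_sat {E n l s t : ℕ} (h : codeOK E n l s t) (ψ : Fml) : ψ.encode ≤ E →
    ∀ w : (codeModel.{u} E n l s t).W,
      ((codeModel.{u} E n l s t).Sat ψ w ↔ rbit t w.down ψ.encode) := by
  obtain ⟨-, h3, -⟩ := h
  induction ψ with
  | var p =>
    intro hE w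
    exact ⟨fun h => h.2, fun h => ⟨hE, h⟩⟩
  | bot =>
    intro hE w
    have := (h3 _ (Nat.lt_succ_of_le hE) _ w.down.2).2.1 (by simp [Fml.encode])
    exact ⟨fun h => h.elim, fun h => absurd h this⟩
  | and ψ χ ih1 ih2 =>
    intro hE w
    have hE' := aux_pair_le hE
    have := (h3 _ (Nat.lt_succ_of_le hE) _ w.down.2).2.2.1 (by simp [Fml.encode])
    rw [this, KModel.Sat, ih1 hE'.1, ih2 hE'.2]
    simp [Fml.encode]
  | or ψ χ ih1 ih2 =>
    intro hE w
    have hE' := aux_pair_le hE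
    have := (h3 _ (Nat.lt_succ_of_le hE) _ w.down.2).2.2.2.1 (by simp [Fml.encode])
    rw [this, KModel.Sat, ih1 hE'.1, ih2 hE'.2]
    simp [Fml.encode]
  | imp ψ χ ih1 ih2 =>
    intro hE w
    have hE' := aux_pair_le hE
    have := (h3 _ (Nat.lt_succ_of_le hE) _ w.down.2).2.2.2.2.1 (by simp [Fml.encode])
    rw [this]
    simp only [Fml.encode, Nat.unpair_pair]
    constructor
    · intro h v hv hwv hs
      exact (ih2 hE'.2 ⟨⟨v, hv⟩⟩).1 (h ⟨⟨v, hv⟩⟩ hwv ((ih1 hE'.1 ⟨⟨v, hv⟩⟩).2 hs))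
    · intro h v hwv hs
      exact (ih2 hE'.2 v).2 (h _ v.down.2 hwv ((ih1 hE'.1 v).1 hs))
  | dia ψ ih =>
    intro hE w
    have hE' : ψ.encode ≤ E := (Nat.right_le_pair 5 _).trans hE
    have := (h3 _ (Nat.lt_succ_of_le hE) _ w.down.2).2.2.2.2.2.1 (by simp [Fml.encode])
    rw [this]
    simp only [Fml.encode, Nat.unpair_pair]
    constructor
    · intro h v hv hwv
      obtain ⟨x, hx, hs⟩ := h ⟨⟨v, hv⟩⟩ hwv
      exact ⟨_, x.down.2, hx, (ih hE' x).1 hs⟩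
    · intro h v hwv
      obtain ⟨x, hx, hvx, hs⟩ := h _ v.down.2 hwv
      exact ⟨⟨⟨x, hx⟩⟩, hvx, (ih hE' ⟨⟨x, hx⟩⟩).2 hs⟩
  | box ψ ih =>
    intro hE w
    have hE' : ψ.encode ≤ E := (Nat.right_le_pair 6 _).trans hE
    have := (h3 _ (Nat.lt_succ_of_le hE) _ w.down.2).2.2.2.2.2.2 (by simp [Fml.encode])
    rw [this]
    simp only [Fml.encode, Nat.unpair_pair]
    constructor
    · intro h v hv x hx hwv hvx
      exact (ih hE' ⟨⟨x, hx⟩⟩).1 (h ⟨⟨v, hv⟩⟩ ⟨⟨x, hx⟩⟩ hwv hvx)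
    · intro h v x hwv hvx
      exact (ih hE' x).2 (h _ v.down.2 _ x.down.2 hwv hvx)

theorem not_valid_of_coded (φ : Fml) (h : codedRefutable φ.encode) : ¬ S4IValid.{u} φ := by
  obtain ⟨n, -, l, -, s, -, t, -, h⟩ := h
  obtain ⟨w, hw, hw'⟩ := h.2.2
  intro hv
  have := hv (codeModel.{u} φ.encode n l s t) ⟨⟨w, hw⟩⟩ (codeModel_S4I h) (fun h => h.elim)
  exact hw' ((codeModel_sat h φ le_rfl ⟨⟨w, hw⟩⟩).1 this)

theorem coded_of_model (N : KModel.{0}) (hN : N.IsS4I) (hf : Finite N.W) (φ : Fml)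
    (hc : Nat.card N.W ≤ sizeBound φ.encode) (v : N.W) (hv : ¬ N.Sat φ v) :
    codedRefutable φ.encode := by
  classical
  obtain ⟨n, ⟨e⟩⟩ := Finite.exists_equiv_fin N.W
  have hn : Nat.card N.W = n := by rw [Nat.card_congr e]; simp
  rw [hn] at hc
  generalize hE : φ.encode = E at *
  obtain ⟨l, hl, hl'⟩ := exists_rbit (sizeBound E) (sizeBound E + E + 1)
    (fun i j => ∃ (hi : i < n) (hj : j < n), N.le (e.symm ⟨i, hi⟩) (e.symm ⟨j, hj⟩))
  obtain ⟨s, hs, hs'⟩ := exists_rbit (sizeBound E) (sizeBound E + E + 1)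
    (fun i j => ∃ (hi : i < n) (hj : j < n), N.sq (e.symm ⟨i, hi⟩) (e.symm ⟨j, hj⟩))
  obtain ⟨t, ht, ht'⟩ := exists_rbit (sizeBound E) (sizeBound E + E + 1)
    (fun i c => ∃ (hi : i < n), N.Sat (decFml c) (e.symm ⟨i, hi⟩))
  refine ⟨n, by omega, l, hl, s, hs, t, ht, ?_⟩
  have L : ∀ x y : N.W, rbit l (e x) (e y) ↔ N.le x y := by
    intro x y
    rw [hl' _ (by omega) _ (by omega)]
    simp
  have S : ∀ x y : N.W, rbit s (e x) (e y) ↔ N.sq x y := by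
    intro x y
    rw [hs' _ (by omega) _ (by omega)]
    simp
  have T : ∀ (x : N.W) c, c ≤ E → (rbit t (e x) c ↔ N.Sat (decFml c) x) := by
    intro x c hc
    rw [ht' _ (by omega) _ (by omega)]
    simp
  have all : ∀ p : ℕ → Prop, (∀ i < n, p i) ↔ ∀ x : N.W, p (e x) := by
    intro p
    constructor
    · intro h x; exact h _ (e x).2
    · intro h i hi
      have := h (e.symm ⟨i, hi⟩)
      simpa using this
  have ex : ∀ p : ℕ → Prop, (∃ i < n, p i) ↔ ∃ x : N.W, p (e x) := by
    intro p
    constructor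
    · rintro ⟨i, hi, h⟩; exact ⟨e.symm ⟨i, hi⟩, by simpa using h⟩
    · rintro ⟨x, hx⟩; exact ⟨_, (e x).2, hx⟩
  obtain ⟨⟨b1, b2, b3, b4, b5, b6, b7, b8⟩, hup, hdown, hinf⟩ := hN
  refine ⟨?_, ?_, ?_⟩
  · simp only [frameOK, all, ex, L, S]
    exact ⟨fun x => ⟨b1 x, b3 x⟩, fun x y z => ⟨b2 x y z, b4 x y z, hup x y z, hdown x y z⟩⟩
  · intro c hc
    have hc0 : c ≤ E := by omega
    have hc1 : c.unpair.2 ≤ E := (Nat.unpair_right_le _).trans hc0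
    have hc2 : c.unpair.2.unpair.1 ≤ E := (Nat.unpair_left_le _).trans hc1
    have hc3 : c.unpair.2.unpair.2 ≤ E := (Nat.unpair_right_le _).trans hc1
    simp only [labOK, all, ex, L, S, T _ _ hc0, T _ _ hc1, T _ _ hc2, T _ _ hc3]
    intro w
    refine ⟨fun h => ?_, fun h => ?_, fun h => ?_, fun h => ?_, fun h => ?_, fun h => ?_,
      fun h => ?_⟩
    · rw [decFml_0 h]; exact fun v h1 h2 => b7 _ _ _ h1 h2
    · rw [decFml_1 h, KModel.Sat, hinf]; exact fun h => h.elim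
    · rw [decFml_2 h]; rfl
    · rw [decFml_3 h]; rfl
    · rw [decFml_4 h]; rfl
    · rw [decFml_5 h]; rfl
    · rw [decFml_6 h]; rfl
  · rw [ex]
    refine ⟨v, ?_⟩
    rw [T _ _ le_rfl, ← hE, decFml_encode]
    exact hv

theorem coded_iff (φ : Fml) : codedRefutable φ.encode ↔ ¬ S4IValid.{u} φ := by
  refine ⟨not_valid_of_coded φ, fun h => ?_⟩
  simp only [S4IValid, not_forall] at h
  obtain ⟨M, w, hM, -, hw⟩ := h
  obtain ⟨N, v, hN, hf, hc, hs⟩ := KModel.fmp hM φ w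
  exact coded_of_model N hN hf φ hc v (by rwa [hs])

/-! ### Computability -/

section computability

variable {α : Type*} [Primcodable α]

theorem pr_pow {f g : α → ℕ} (hf : Primrec f) (hg : Primrec g) :
    Primrec fun a => f a ^ g a := by
  have h : Primrec₂ ((· ^ ·) : ℕ → ℕ → ℕ) := Primrec₂.unpaired'.1 Nat.Primrec.pow
  exact h.comp hf hg

theorem pp_nbit {f g : α → ℕ} (hf : Primrec f) (hg : Primrec g) :
    PrimrecPred fun a => nbit (f a) (g a) := by
  unfold nbit
  exact Primrec.eq.comp (Primrec.nat_mod.comp (Primrec.nat_div.comp hf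
    (pr_pow (Primrec.const 2) hg)) (Primrec.const 2)) (Primrec.const 1)

theorem pp_rbit {f g h : α → ℕ} (hf : Primrec f) (hg : Primrec g) (hh : Primrec h) :
    PrimrecPred fun a => rbit (f a) (g a) (h a) :=
  pp_nbit hf (Primrec₂.natPair.comp hg hh)

theorem pp_imp {p q : α → Prop} (hp : PrimrecPred p) (hq : PrimrecPred q) :
    PrimrecPred fun a => p a → q a :=
  (hp.not.or hq).of_eq fun a => by tauto

theorem pp_iff {p q : α → Prop} (hp : PrimrecPred p) (hq : PrimrecPred q) :
    PrimrecPred fun a => (p a ↔ q a) :=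
  ((pp_imp hp hq).and (pp_imp hq hp)).of_eq fun a => by tauto

theorem pp_ex {f : α → ℕ} {p : α → ℕ → Prop} (hf : Primrec f)
    (hp : PrimrecPred fun x : α × ℕ => p x.1 x.2) : PrimrecPred fun a => ∃ x < f a, p a x := by
  have h : PrimrecRel fun (x : ℕ) (a : α) => p a x :=
    hp.comp (f := fun y : ℕ × α => (y.2, y.1)) (Primrec.snd.pair Primrec.fst)
  exact ((PrimrecRel.exists_mem_list h).comp (Primrec.list_range.comp hf) Primrec.id).of_eq
    (by simp)

theorem pp_all {f : α → ℕ} {p : α → ℕ → Prop} (hf : Primrec f)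
    (hp : PrimrecPred fun x : α × ℕ => p x.1 x.2) : PrimrecPred fun a => ∀ x < f a, p a x := by
  have h : PrimrecRel fun (x : ℕ) (a : α) => p a x :=
    hp.comp (f := fun y : ℕ × α => (y.2, y.1)) (Primrec.snd.pair Primrec.fst)
  exact ((PrimrecRel.forall_mem_list h).comp (Primrec.list_range.comp hf) Primrec.id).of_eq
    (by simp)

theorem pr_un1 {f : α → ℕ} (hf : Primrec f) : Primrec fun a => (f a).unpair.1 :=
  Primrec.fst.comp (Primrec.unpair.comp hf)

theorem pr_un2 {f : α → ℕ} (hf : Primrec f) : Primrec fun a => (f a).unpair.2 :=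
  Primrec.snd.comp (Primrec.unpair.comp hf)

theorem pp_eq {f g : α → ℕ} (hf : Primrec f) (hg : Primrec g) : PrimrecPred fun a => f a = g a :=
  Primrec.eq.comp hf hg

theorem pp_frameOK {n l s : α → ℕ} (hn : Primrec n) (hl : Primrec l) (hs : Primrec s) :
    PrimrecPred fun a => frameOK (n a) (l a) (s a) := by
  unfold frameOK
  have c1 {γ : Type _} [Primcodable γ] {f : γ → ℕ} (hf : Primrec f) :
    Primrec fun x : γ × ℕ => f x.1 := hf.comp Primrec.fst
  have n1 := c1 hn
  have l1 := c1 hl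
  have s1 := c1 hs
  have i1 : Primrec fun x : α × ℕ => x.2 := Primrec.snd
  have n2 := c1 n1
  have l2 := c1 l1
  have s2 := c1 s1
  have i2 := c1 i1
  have j2 : Primrec fun x : (α × ℕ) × ℕ => x.2 := Primrec.snd
  have n3 := c1 n2
  have l3 := c1 l2
  have s3 := c1 s2
  have i3 := c1 i2
  have j3 := c1 j2
  have k3 : Primrec fun x : ((α × ℕ) × ℕ) × ℕ => x.2 := Primrec.snd
  have l4 := c1 l3
  have s4 := c1 s3
  have i4 := c1 i3
  have j4 := c1 j3
  have k4 := c1 k3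
  have x4 : Primrec fun x : (((α × ℕ) × ℕ) × ℕ) × ℕ => x.2 := Primrec.snd
  refine PrimrecPred.and (pp_all hn ((pp_rbit l1 i1 i1).and (pp_rbit s1 i1 i1)))
    (pp_all hn (pp_all n1 (pp_all n2 ?_)))
  refine PrimrecPred.and (pp_imp (pp_rbit l3 i3 j3) (pp_imp (pp_rbit l3 j3 k3) (pp_rbit l3 i3 k3)))
    (PrimrecPred.and
      (pp_imp (pp_rbit s3 i3 j3) (pp_imp (pp_rbit s3 j3 k3) (pp_rbit s3 i3 k3)))
    (PrimrecPred.and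
      (pp_imp (pp_rbit l3 i3 j3) (pp_imp (pp_rbit s3 i3 k3)
        (pp_ex n3 ((pp_rbit l4 k4 x4).and (pp_rbit s4 j4 x4)))))
      (pp_imp (pp_rbit l3 i3 j3) (pp_imp (pp_rbit s3 j3 k3)
        (pp_ex n3 ((pp_rbit s4 i4 x4).and (pp_rbit l4 x4 k4)))))))

theorem pp_labOK {n l s t c w : α → ℕ} (hn : Primrec n) (hl : Primrec l) (hs : Primrec s)
    (ht : Primrec t) (hc : Primrec c) (hw : Primrec w) :
    PrimrecPred fun a => labOK (n a) (l a) (s a) (t a) (c a) (w a) := by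
  unfold labOK
  have c1 {γ : Type _} [Primcodable γ] {f : γ → ℕ} (hf : Primrec f) :
    Primrec fun x : γ × ℕ => f x.1 := hf.comp Primrec.fst
  have tag (k : ℕ) : PrimrecPred fun a => (c a).unpair.1 = k :=
    pp_eq (pr_un1 hc) (Primrec.const k)
  have d := pr_un2 hc
  have d1 := pr_un1 d
  have d2 := pr_un2 d
  have n1 := c1 hn
  have l1 := c1 hl
  have s1 := c1 hs
  have t1 := c1 ht
  have w1 := c1 hw
  have v1 : Primrec fun x : α × ℕ => x.2 := Primrec.snd
  have s2 := c1 s1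
  have l2 := c1 l1
  have t2 := c1 t1
  have w2 := c1 w1
  have v2 := c1 v1
  have x2 : Primrec fun x : (α × ℕ) × ℕ => x.2 := Primrec.snd
  have T := pp_rbit ht hw hc
  refine PrimrecPred.and (pp_imp (tag 0) (pp_all hn (pp_imp (pp_rbit t1 w1 (c1 hc))
    (pp_imp (pp_rbit l1 w1 v1) (pp_rbit t1 v1 (c1 hc)))))) ?_
  refine PrimrecPred.and (pp_imp (tag 1) T.not) ?_
  refine PrimrecPred.and (pp_imp (tag 2) (pp_iff T
    ((pp_rbit ht hw d1).and (pp_rbit ht hw d2)))) ?_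
  refine PrimrecPred.and (pp_imp (tag 3) (pp_iff T
    ((pp_rbit ht hw d1).or (pp_rbit ht hw d2)))) ?_
  refine PrimrecPred.and (pp_imp (tag 4) (pp_iff T (pp_all hn (pp_imp (pp_rbit l1 w1 v1)
    (pp_imp (pp_rbit t1 v1 (c1 d1)) (pp_rbit t1 v1 (c1 d2))))))) ?_
  refine PrimrecPred.and (pp_imp (tag 5) (pp_iff T (pp_all hn (pp_imp (pp_rbit l1 w1 v1)
    (pp_ex n1 ((pp_rbit s2 v2 x2).and (pp_rbit t2 x2 (c1 (c1 d))))))))) ?_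
  exact pp_imp (tag 6) (pp_iff T (pp_all hn (pp_all n1 (pp_imp (pp_rbit l2 w2 v2)
    (pp_imp (pp_rbit s2 v2 x2) (pp_rbit t2 x2 (c1 (c1 d))))))))

theorem pp_codeOK {E n l s t : α → ℕ} (hE : Primrec E) (hn : Primrec n) (hl : Primrec l)
    (hs : Primrec s) (ht : Primrec t) :
    PrimrecPred fun a => codeOK (E a) (n a) (l a) (s a) (t a) := by
  unfold codeOK
  have c1 {γ : Type _} [Primcodable γ] {f : γ → ℕ} (hf : Primrec f) :
    Primrec fun x : γ × ℕ => f x.1 := hf.comp Primrec.fst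
  have v1 : Primrec fun x : α × ℕ => x.2 := Primrec.snd
  have v2 : Primrec fun x : (α × ℕ) × ℕ => x.2 := Primrec.snd
  refine (pp_frameOK hn hl hs).and (PrimrecPred.and ?_ ?_)
  · exact pp_all (Primrec.succ.comp hE) (pp_all (c1 hn) (pp_labOK (c1 (c1 hn)) (c1 (c1 hl))
      (c1 (c1 hs)) (c1 (c1 ht)) (c1 v1) v2))
  · exact pp_ex hn (pp_rbit (c1 ht) v1 (c1 hE)).not

theorem pr_tyCard {E k : α → ℕ} (hE : Primrec E) (hk : Primrec k) :
    Primrec fun a => tyCard (E a) (k a) := by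
  unfold tyCard
  have h2 : Primrec fun a => 2 ^ (E a + 1) := pr_pow (Primrec.const 2) (Primrec.succ.comp hE)
  refine Primrec.nat_rec' hk h2 (h := fun a x => 2 ^ (E a + 1) * 2 ^ x.2) ?_
  exact Primrec.nat_mul.comp (h2.comp Primrec.fst)
    (pr_pow (Primrec.const 2) (Primrec.snd.comp Primrec.snd))

theorem pr_sizeBound : Primrec sizeBound := by
  unfold sizeBound
  exact pr_pow (Primrec.succ.comp (pr_tyCard Primrec.id Primrec.succ))
    (Primrec.succ.comp Primrec.succ)

theorem pr_codeBound : Primrec codeBound := by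
  unfold codeBound
  have h : Primrec fun E => sizeBound E + (sizeBound E + E + 1) + 1 :=
    Primrec.succ.comp (Primrec.nat_add.comp pr_sizeBound
      (Primrec.succ.comp (Primrec.nat_add.comp pr_sizeBound Primrec.id)))
  exact pr_pow (Primrec.const 2) (Primrec.nat_mul.comp h h)

theorem pp_codedRefutable : PrimrecPred codedRefutable := by
  unfold codedRefutable
  have c1 {γ : Type} [Primcodable γ] {f : γ → ℕ} (hf : Primrec f) :
    Primrec fun x : γ × ℕ => f x.1 := hf.comp Primrec.fst
  have b0 := pr_codeBound
  have b1 := c1 b0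
  have b2 := c1 b1
  have b3 := c1 b2
  have E0 : Primrec fun x : ℕ => x := Primrec.id
  have v1 : Primrec fun x : ℕ × ℕ => x.2 := Primrec.snd
  have v2 : Primrec fun x : (ℕ × ℕ) × ℕ => x.2 := Primrec.snd
  have v3 : Primrec fun x : ((ℕ × ℕ) × ℕ) × ℕ => x.2 := Primrec.snd
  have v4 : Primrec fun x : (((ℕ × ℕ) × ℕ) × ℕ) × ℕ => x.2 := Primrec.snd
  exact pp_ex (Primrec.succ.comp pr_sizeBound) (pp_ex b1 (pp_ex b2 (pp_ex b3
    (pp_codeOK (c1 (c1 (c1 (c1 E0)))) (c1 (c1 (c1 v1))) (c1 (c1 v2)) (c1 v3) v4))))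

end computability

theorem s4i_decidable :
    ∃ f : ℕ → Bool, Computable f ∧ ∀ φ : Fml, (f φ.encode = true ↔ S4IValid.{u} φ) := by
  obtain ⟨_, h⟩ := pp_codedRefutable.not
  refine ⟨_, h.to_comp, fun φ => ?_⟩
  rw [decide_eq_true_iff]
  show ¬ codedRefutable φ.encode ↔ _
  rw [coded_iff.{u}, not_not]

/-- **The finite frame property for S4I, and decidability.**
If an `L`-formula `φ` is falsifiable (respectively, satisfiable) on some S4I frame,
then `φ` is falsifiable (respectively, satisfiable) on some S4I frame whose set of
worlds is finite. Consequently, validity on the class of S4I frames is decidable: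
there is a computable function deciding validity through the encoding of formulas
as natural numbers. -/
theorem s4i_finite_frame_property_and_decidable :
    (∀ φ : Fml,
      ((∃ (M : KModel.{u}) (w : M.W), M.IsS4I ∧ w ∉ M.fallible ∧ ¬ M.Sat φ w) →
        ∃ (N : KModel.{0}) (v : N.W), N.IsS4I ∧ Finite N.W ∧ v ∉ N.fallible ∧ ¬ N.Sat φ v) ∧
      ((∃ (M : KModel.{u}) (w : M.W), M.IsS4I ∧ w ∉ M.fallible ∧ M.Sat φ w) →
        ∃ (N : KModel.{0}) (v : N.W), N.IsS4I ∧ Finite N.W ∧ v ∉ N.fallible ∧ N.Sat φ v)) ∧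
    (∃ f : ℕ → Bool, Computable f ∧ ∀ φ : Fml, (f φ.encode = true ↔ S4IValid.{u} φ)) := by
  refine ⟨fun φ => ⟨?_, ?_⟩, s4i_decidable⟩
  · rintro ⟨M, w, hM, -, hw⟩
    obtain ⟨N, v, hN, hf, -, hs⟩ := KModel.fmp hM φ w
    exact ⟨N, v, hN, hf, by rw [hN.2.2.2]; exact fun h => h.elim, by rwa [hs]⟩
  · rintro ⟨M, w, hM, -, hw⟩
    obtain ⟨N, v, hN, hf, -, hs⟩ := KModel.fmp hM φ w
    exact ⟨N, v, hN, hf, by rw [hN.2.2.2]; exact fun h => h.elim, by rwa [hs]⟩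
end
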